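/- arXiv:1710.03397 — 2 statements merged into one kernel-verified Lean document; each statement's English description precedes it below -/
import Mathlib

section
/- Let 0 ≤ α < d and 1 ≤ p ≤ q < ∞ satisfy 1/p − 1/q ≤ α/d, and let (U,V) be a pair of n×n matrix weights on ℝ^d. Then the following are equivalent: (1) [U,V]_{A_{p,q}^α} < ∞; (2) the auxiliary maximal operator M'_{α,U,V} maps L^p(ℝ^d,ℂ^n) boundedly into weak L^{q,∞}(ℝ^d); (3) for every cube Q the operator B_Q^α maps L^p(ℝ^d,ℂ^n) into L^{q,∞}(ℝ^d) with norm bounded independently of Q. -/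
open MeasureTheory ENNReal
open scoped NNReal ComplexOrder

noncomputable section

abbrev Rd (d : ℕ) := EuclideanSpace ℝ (Fin d)
abbrev Cn (n : ℕ) := EuclideanSpace ℂ (Fin n)
abbrev Mat (n : ℕ) := Matrix (Fin n) (Fin n) ℂ

/-- An axis-parallel (half-open) cube in `ℝ^d`. -/
structure Cube (d : ℕ) where
  corner : Fin d → ℝ
  side : ℝ
  side_pos : 0 < side

namespace Cube

/-- The set of points of a cube. -/
def set {d : ℕ} (Q : Cube d) : Set (Rd d) :=
  {x | ∀ i, Q.corner i ≤ x i ∧ x i < Q.corner i + Q.side}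

/-- The volume `|Q|` of a cube. -/
def vol {d : ℕ} (Q : Cube d) : ℝ := Q.side ^ d

end Cube

/-- A matrix acting on `ℂ^n` (with the Euclidean norm). -/
def mulVecE {n : ℕ} (A : Mat n) (v : Cn n) : Cn n :=
  Matrix.toEuclideanLin A v

/-- The operator norm `|A|_op` of a matrix acting on `ℓ²(ℂ^n)`. -/
def opNorm {n : ℕ} (A : Mat n) : ℝ :=
  ‖Matrix.toEuclideanCLM (𝕜 := ℂ) A‖

/-- Real powers of a self-adjoint matrix, defined via diagonalization. -/
def matPow {n : ℕ} (A : Mat n) (r : ℝ) : Mat n :=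
  if hA : A.IsHermitian then
    (hA.eigenvectorUnitary : Mat n) *
      Matrix.diagonal (fun i => ((hA.eigenvalues i ^ r : ℝ) : ℂ)) *
      (star hA.eigenvectorUnitary : Mat n)
  else A

/-- A matrix weight: self-adjoint matrix valued, locally integrable entries,
positive definite a.e. -/
def IsMatrixWeight {d n : ℕ} (U : Rd d → Mat n) : Prop :=
  (∀ i j, MeasureTheory.LocallyIntegrable (fun x => U x i j) volume) ∧
    (∀ᵐ x, (U x).PosDef)

/-- A Young function: convex, increasing, `Φ(0) = 0` and `Φ(t)/t → ∞`. -/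
structure IsYoungFunction (Φ : ℝ → ℝ) : Prop where
  convexOn : ConvexOn ℝ (Set.Ici 0) Φ
  monotoneOn : MonotoneOn Φ (Set.Ici 0)
  map_zero : Φ 0 = 0
  tendsto : Filter.Tendsto (fun t => Φ t / t) Filter.atTop Filter.atTop

/-- The associate Young function `Φ̄(t) = sup_{s>0} (st - Φ(s))`. -/
def assoc (Φ : ℝ → ℝ) : ℝ → ℝ :=
  fun t => sSup ((fun s => s * t - Φ s) '' Set.Ioi (0 : ℝ))

/-- The `B_{p,q}` condition: `∫_1^∞ Φ(t)^{q/p} t^{-q} dt/t < ∞`. -/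
def MemBpq (Φ : ℝ → ℝ) (p q : ℝ) : Prop :=
  ∫⁻ t in Set.Ioi (1 : ℝ), ENNReal.ofReal (Φ t ^ (q / p) / t ^ (q + 1)) < ⊤

/-- The `B_p` condition: `∫_1^∞ Φ(t) t^{-p} dt/t < ∞`. -/
def MemBp (Φ : ℝ → ℝ) (p : ℝ) : Prop :=
  ∫⁻ t in Set.Ioi (1 : ℝ), ENNReal.ofReal (Φ t / t ^ (p + 1)) < ⊤

/-- Localized Luxemburg (Orlicz) norm over a cube, for `ℝ≥0∞`-valued functions. -/
def luxNormE {d : ℕ} (Φ : ℝ → ℝ) (Q : Cube d) (f : Rd d → ℝ≥0∞) : ℝ≥0∞ :=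
  sInf {lam : ℝ≥0∞ | 0 < lam ∧ lam < ⊤ ∧
    (∫⁻ x in Q.set, ENNReal.ofReal (Φ ((f x).toReal / lam.toReal))) ≤ ENNReal.ofReal Q.vol}

/-- Localized Luxemburg (Orlicz) norm over a cube of a real valued function. -/
def luxNorm {d : ℕ} (Φ : ℝ → ℝ) (Q : Cube d) (f : Rd d → ℝ) : ℝ≥0∞ :=
  luxNormE Φ Q fun x => ENNReal.ofReal |f x|

/-- The (unweighted) `L^p` norm of a vector valued function. -/
def lpNorm {d n : ℕ} (p : ℝ) (f : Rd d → Cn n) : ℝ≥0∞ :=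
  (∫⁻ x, (‖f x‖₊ : ℝ≥0∞) ^ p) ^ (1 / p)

/-- The matrix-weighted `L^p(W)` norm `(∫ |W^{1/p} f|^p)^{1/p}`. -/
def wLpNorm {d n : ℕ} (p : ℝ) (W : Rd d → Mat n) (f : Rd d → Cn n) : ℝ≥0∞ :=
  (∫⁻ x, (‖mulVecE (matPow (W x) (1 / p)) (f x)‖₊ : ℝ≥0∞) ^ p) ^ (1 / p)


/-- The two-weight matrix `A_{p,q}^α` constant (for `p > 1`). -/
def matrixApq {d n : ℕ} (α p q : ℝ) (U V : Rd d → Mat n) : ℝ≥0∞ :=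
  ⨆ Q : Cube d,
    ENNReal.ofReal (Q.vol ^ (α / (d : ℝ) + 1 / q - 1 / p)) *
      ((ENNReal.ofReal Q.vol)⁻¹ *
        ∫⁻ x in Q.set,
          ((ENNReal.ofReal Q.vol)⁻¹ *
            ∫⁻ y in Q.set,
              ENNReal.ofReal (opNorm (matPow (U x) (1 / q) * matPow (V y) (-(1 / p)))) ^
                (p / (p - 1))) ^ (q * (p - 1) / p)) ^ (1 / q)

/-- The two-weight matrix `A_{1,q}^α` constant. -/
def matrixA1q {d n : ℕ} (α q : ℝ) (U V : Rd d → Mat n) : ℝ≥0∞ :=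
  ⨆ Q : Cube d,
    ENNReal.ofReal (Q.vol ^ (α / (d : ℝ) + 1 / q - 1)) *
      essSup (fun y =>
          ((ENNReal.ofReal Q.vol)⁻¹ *
            ∫⁻ x in Q.set,
              ENNReal.ofReal (opNorm (matPow (U x) (1 / q) * (V y)⁻¹)) ^ q) ^ (1 / q))
        (volume.restrict Q.set)

/-- The two-weight matrix `A_{p,q}^α` constant for `1 ≤ p ≤ q`. -/
def matrixApqFull {d n : ℕ} (α p q : ℝ) (U V : Rd d → Mat n) : ℝ≥0∞ :=
  if p = 1 then matrixA1q α q U V else matrixApq α p q U V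

/-- `M` is a reducing operator of `U^{1/q}` on the cube `Q`, with comparability
constants `c₁, c₂`: `|M e| ≈ (⨍_Q |U^{1/q}(x) e|^q dx)^{1/q}` for all `e`. -/
def ReducesLq {d n : ℕ} (q c₁ c₂ : ℝ) (U : Rd d → Mat n) (Q : Cube d) (M : Mat n) : Prop :=
  M.PosDef ∧ ∀ e : Cn n,
    ENNReal.ofReal c₁ *
        (((ENNReal.ofReal Q.vol)⁻¹ *
          ∫⁻ x in Q.set, (‖mulVecE (matPow (U x) (1 / q)) e‖₊ : ℝ≥0∞) ^ q) ^ (1 / q)) ≤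
      (‖mulVecE M e‖₊ : ℝ≥0∞) ∧
    (‖mulVecE M e‖₊ : ℝ≥0∞) ≤
      ENNReal.ofReal c₂ *
        (((ENNReal.ofReal Q.vol)⁻¹ *
          ∫⁻ x in Q.set, (‖mulVecE (matPow (U x) (1 / q)) e‖₊ : ℝ≥0∞) ^ q) ^ (1 / q))

/-- The auxiliary maximal operator `M'_{α,U,V}` built from the reducing operators `𝒰 Q`. -/
def auxMaxOp {d n : ℕ} (α p : ℝ) (𝒰 : Cube d → Mat n) (V : Rd d → Mat n)
    (f : Rd d → Cn n) (x : Rd d) : ℝ≥0∞ :=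
  ⨆ (Q : Cube d) (_ : x ∈ Q.set),
    ENNReal.ofReal (Q.vol ^ (α / (d : ℝ) - 1)) *
      ∫⁻ y in Q.set, (‖mulVecE (𝒰 Q) (mulVecE (matPow (V y) (-(1 / p))) (f y))‖₊ : ℝ≥0∞)

/-- The averaging operator `B_Q^α` built from the reducing operator `𝒰 Q`. -/
def auxAvgOp {d n : ℕ} (α p : ℝ) (𝒰 : Cube d → Mat n) (V : Rd d → Mat n) (Q : Cube d)
    (f : Rd d → Cn n) (x : Rd d) : ℝ≥0∞ :=
  Q.set.indicator (fun _ =>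
    ENNReal.ofReal (Q.vol ^ (α / (d : ℝ) - 1)) *
      ∫⁻ y in Q.set, (‖mulVecE (𝒰 Q) (mulVecE (matPow (V y) (-(1 / p))) (f y))‖₊ : ℝ≥0∞)) x

/-- `S` maps `L^p(ℝ^d,ℂ^n)` into `L^{q,∞}(ℝ^d)` with constant `C`. -/
def WeakLqBound {d n : ℕ} (p q C : ℝ) (S : (Rd d → Cn n) → Rd d → ℝ≥0∞) : Prop :=
  ∀ f : Rd d → Cn n, ∀ lam : ℝ, 0 < lam →
    ENNReal.ofReal lam * volume {x | ENNReal.ofReal lam < S f x} ^ (1 / q) ≤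
      ENNReal.ofReal C * lpNorm p f

section MatrixPowers

open scoped Matrix.Norms.L2Operator

lemma matPow_eq_cfc {n : ℕ} {A : Mat n} (hA : A.IsHermitian) (r : ℝ) :
    matPow A r = cfc (fun t : ℝ => t ^ r) A := by
  rw [hA.cfc_eq, matPow, dif_pos hA, Matrix.IsHermitian.cfc, Unitary.conjStarAlgAut_apply]
  rfl

lemma continuousOn_matPow_posDef {n : ℕ} (r : ℝ) :
    ContinuousOn (fun A : Mat n => matPow A r) {A | A.PosDef} := by
  have key : ContinuousOn (fun A : Mat n => cfc (fun t : ℝ => t ^ r) A) {A | A.PosDef} := by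
    refine ContinuousOn.cfc_of_mem_nhdsSet (s := Set.Ioi (0 : ℝ)) (fun t : ℝ => t ^ r)
      ?_ continuousOn_id ?_ ?_
    · refine (isOpen_Ioi.mem_nhdsSet).2 (Set.iUnion₂_subset fun A hA t ht => ?_)
      have hA' : A.PosDef := hA
      rw [hA'.isHermitian.spectrum_real_eq_range_eigenvalues] at ht
      obtain ⟨i, rfl⟩ := ht
      exact hA'.eigenvalues_pos i
    · exact fun A hA => (show A.PosDef from hA).isHermitian
    · exact fun t ht => (Real.continuousAt_rpow_const t r (Or.inl (ne_of_gt ht))).continuousWithinAt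
  exact key.congr fun A hA => matPow_eq_cfc (show A.PosDef from hA).isHermitian r

lemma matPow_neg_one {n : ℕ} {A : Mat n} (hA : A.PosDef) : matPow A (-1) = A⁻¹ := by
  symm
  apply Matrix.inv_eq_right_inv
  rw [matPow_eq_cfc hA.isHermitian]
  have hpos : ∀ t ∈ spectrum ℝ A, 0 < t := by
    intro t ht
    rw [hA.isHermitian.spectrum_real_eq_range_eigenvalues] at ht
    obtain ⟨i, rfl⟩ := ht
    exact hA.eigenvalues_pos i
  have hsa : IsSelfAdjoint A := hA.isHermitian
  have hc : ContinuousOn (fun t : ℝ => t ^ (-1 : ℝ)) (spectrum ℝ A) := fun t ht =>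
    (Real.continuousAt_rpow_const t _ (Or.inl (hpos t ht).ne')).continuousWithinAt
  calc A * cfc (fun t : ℝ => t ^ (-1 : ℝ)) A
      = cfc (fun t : ℝ => t) A * cfc (fun t : ℝ => t ^ (-1 : ℝ)) A := by
        rw [cfc_id' ℝ A]
    _ = cfc (fun t : ℝ => t * t ^ (-1 : ℝ)) A := by
        rw [← cfc_mul (fun t : ℝ => t) _ A continuousOn_id hc]
    _ = cfc (fun _ : ℝ => (1 : ℝ)) A := by
        refine cfc_congr fun t ht => ?_
        simp only [Real.rpow_neg_one]
        exact mul_inv_cancel₀ (hpos t ht).ne'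
    _ = 1 := cfc_const_one ℝ A

end MatrixPowers

/-- Powers of a matrix weight, as measurable fields of operators. -/
lemma IsMatrixWeight.aestronglyMeasurable_matPow {d n : ℕ} {U : Rd d → Mat n}
    (hU : IsMatrixWeight U) (r : ℝ) :
    AEStronglyMeasurable (fun x => Matrix.toEuclideanCLM (𝕜 := ℂ) (matPow (U x) r)) volume := by
  have hcont : ContinuousOn (fun A : Mat n => Matrix.toEuclideanCLM (𝕜 := ℂ) (matPow A r))
      {A | A.PosDef} :=
    (LinearMap.continuous_of_finiteDimensional
      (Matrix.toEuclideanCLM (𝕜 := ℂ) (n := Fin n)).toAlgEquiv.toLinearMap).comp_continuousOn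
      (continuousOn_matPow_posDef r)
  let _ : MeasurableSpace (Mat n) := borel _
  have : BorelSpace (Mat n) := ⟨rfl⟩
  have : SecondCountableTopology (Mat n) :=
    inferInstanceAs (SecondCountableTopology (Fin n → Fin n → ℂ))
  have hmeas : AEMeasurable U volume := by
    have h : AEStronglyMeasurable U volume := by
      have h' : AEMeasurable (fun x i j => U x i j) volume :=
        aemeasurable_pi_lambda _ fun i => aemeasurable_pi_lambda _ fun j =>
          (hU.1 i j).aestronglyMeasurable.aemeasurable
      exact h'.aestronglyMeasurable
    exact h.aemeasurable
  obtain ⟨U', hU'm, hUU'⟩ := hmeas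
  have hae : ∀ᵐ x, (U' x).PosDef ∧ U x = U' x := by
    filter_upwards [hU.2, hUU'] with x h1 h2 using ⟨h2 ▸ h1, h2⟩
  obtain ⟨s, hsub, hs, hs0⟩ := exists_measurable_superset_of_null (ae_iff.1 hae)
  have hgood : ∀ x ∉ s, (U' x).PosDef ∧ U x = U' x := fun x hx => by
    by_contra h; exact hx (hsub h)
  classical
  have hpd : ∀ x, (s.piecewise (fun _ => (1 : Mat n)) U' x) ∈ {A : Mat n | A.PosDef} := by
    intro x
    by_cases hx : x ∈ s
    · simpa [hx] using Matrix.PosDef.one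
    · simpa [hx] using (hgood x hx).1
  have hm : Measurable (fun x => (⟨_, hpd x⟩ : {A : Mat n | A.PosDef})) :=
    (Measurable.piecewise hs measurable_const hU'm).subtype_mk
  have hm2 := (continuousOn_iff_continuous_domRestrict.1 hcont).comp_stronglyMeasurable
    hm.stronglyMeasurable
  refine ⟨_, hm2, ?_⟩
  filter_upwards [measure_eq_zero_iff_ae_notMem.1 hs0] with x hx
  simp [Set.piecewise, hx, (hgood x hx).2]

section Duality

variable {X : Type*} [MeasurableSpace X] {μ : Measure X} {p p' : ℝ}

/-- Hölder's inequality for lower integrals: only one factor has to be measurable. -/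
lemma lintegral_mul_le_of_aemeasurable_left (hpp' : p.HolderConjugate p') {K f : X → ℝ≥0∞}
    (hK : AEMeasurable K μ) (hKtop : ∀ y, K y ≠ ⊤) :
    ∫⁻ y, K y * f y ∂μ ≤ (∫⁻ y, K y ^ p' ∂μ) ^ (1 / p') * (∫⁻ y, f y ^ p ∂μ) ^ (1 / p) := by
  obtain ⟨g, hg, hgle, hgeq⟩ := exists_measurable_le_lintegral_eq μ (fun y => K y * f y)
  have hfac : ∀ y, K y * (g y / K y) = g y := by
    intro y
    by_cases h0 : K y = 0
    · have := hgle y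
      simp only [h0, zero_mul, nonpos_iff_eq_zero] at this
      simp [h0, this]
    · exact ENNReal.mul_div_cancel h0 (hKtop y)
  have hdiv : ∀ y, g y / K y ≤ f y := fun y =>
    ENNReal.div_le_of_le_mul (by rw [mul_comm]; exact hgle y)
  calc ∫⁻ y, K y * f y ∂μ = ∫⁻ y, K y * (g y / K y) ∂μ := by
        rw [hgeq]; exact lintegral_congr fun y => (hfac y).symm
    _ ≤ (∫⁻ y, K y ^ p' ∂μ) ^ (1 / p') * (∫⁻ y, (g y / K y) ^ p ∂μ) ^ (1 / p) :=
        ENNReal.lintegral_mul_le_Lp_mul_Lq μ hpp'.symm hK (hg.aemeasurable.div hK)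
    _ ≤ _ := by
        gcongr with y
        · exact one_div_nonneg.2 hpp'.nonneg
        · exact hpp'.nonneg
        · exact hdiv y

/-- The converse of Hölder's inequality, tested on bounded functions `h` for which `h * s` is
bounded as well. -/
lemma lintegral_rpow_le_of_forall_lintegral_mul_le [IsFiniteMeasure μ]
    (hpp' : p.HolderConjugate p') {k s : X → ℝ≥0} (hk : AEMeasurable k μ) (hs : AEMeasurable s μ)
    {C : ℝ≥0∞}
    (H : ∀ h : X → ℝ≥0, AEMeasurable h μ → (∃ N : ℝ≥0, ∀ y, h y ≤ N ∧ h y * s y ≤ N) →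
      ∫⁻ y, (k y : ℝ≥0∞) * h y ∂μ ≤ C * (∫⁻ y, (h y : ℝ≥0∞) ^ p ∂μ) ^ (1 / p)) :
    (∫⁻ y, (k y : ℝ≥0∞) ^ p' ∂μ) ^ (1 / p') ≤ C := by
  have hp0 : 0 < p := hpp'.pos
  have hp'0 : 0 < p' := hpp'.symm.pos
  have hp'1 : 0 < p' - 1 := sub_pos.2 hpp'.symm.lt
  set E : ℕ → Set X := fun N => {y | k y ≤ (N : ℝ≥0) ∧ s y ≤ (N : ℝ≥0)}
  have hE : ∀ N, NullMeasurableSet (E N) μ := fun N =>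
    NullMeasurableSet.inter (nullMeasurableSet_le (g := fun _ => (N : ℝ≥0)) hk aemeasurable_const)
      (nullMeasurableSet_le (g := fun _ => (N : ℝ≥0)) hs aemeasurable_const)
  set F : ℕ → X → ℝ≥0∞ := fun N => (E N).indicator fun y => (k y : ℝ≥0∞) ^ p'
  have hF : ∀ N, AEMeasurable (F N) μ := fun N =>
    (hk.coe_nnreal_ennreal.pow_const p').indicator₀ (hE N)
  have hbound : ∀ N, (∫⁻ y, F N y ∂μ) ≤ C ^ p' := by
    intro N
    set h : X → ℝ≥0 := (E N).indicator fun y => k y ^ (p' - 1)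
    have h1 : ∫⁻ y, (k y : ℝ≥0∞) * h y ∂μ = ∫⁻ y, F N y ∂μ := by
      refine lintegral_congr fun y => ?_
      by_cases hy : y ∈ E N
      · simp only [h, F, Set.indicator_of_mem hy]
        rw [ENNReal.coe_rpow_of_nonneg _ hp'1.le]
        conv_lhs => enter [1]; rw [← ENNReal.rpow_one (k y : ℝ≥0∞)]
        rw [← ENNReal.rpow_add_of_nonneg _ _ zero_le_one hp'1.le]
        congr 1; ring
      · simp [h, F, hy]
    have h2 : ∫⁻ y, (h y : ℝ≥0∞) ^ p ∂μ = ∫⁻ y, F N y ∂μ := by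
      refine lintegral_congr fun y => ?_
      by_cases hy : y ∈ E N
      · simp only [h, F, Set.indicator_of_mem hy]
        rw [ENNReal.coe_rpow_of_nonneg _ hp'1.le, ← ENNReal.rpow_mul, hpp'.symm.sub_one_mul_conj]
      · simp [h, F, hy, hp0]
    have hfin : ∫⁻ y, F N y ∂μ ≠ ⊤ := by
      refine ne_top_of_le_ne_top (b := ∫⁻ _, (N : ℝ≥0∞) ^ p' ∂μ) ?_ (lintegral_mono fun y => ?_)
      · rw [lintegral_const]
        exact ENNReal.mul_ne_top (ENNReal.rpow_ne_top_of_nonneg hp'0.le (by simp))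
          (measure_ne_top _ _)
      · refine Set.indicator_apply_le' (fun hy => ?_) (fun _ => zero_le)
        exact ENNReal.rpow_le_rpow (by exact_mod_cast hy.1) hp'0.le
    have h3 := H h ((hk.pow_const _).indicator₀ (hE N)) ⟨(N : ℝ≥0) ^ (p' - 1) * max 1 (N : ℝ≥0), by
      intro y
      by_cases hy : y ∈ E N
      · simp only [h, Set.indicator_of_mem hy]
        have hle : k y ^ (p' - 1) ≤ (N : ℝ≥0) ^ (p' - 1) := NNReal.rpow_le_rpow hy.1 hp'1.le
        exact ⟨hle.trans (le_mul_of_one_le_right' (le_max_left _ _)),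
          mul_le_mul' hle (hy.2.trans (le_max_right _ _))⟩
      · simp [h, hy]⟩
    rw [h1, h2] at h3
    set I := ∫⁻ y, F N y ∂μ
    rcases eq_or_ne I 0 with h0 | h0
    · simp [h0]
    have hI : I ^ (1 / p') ≤ C := by
      have hsplit : I = I ^ (1 / p') * I ^ (1 / p) := by
        rw [← ENNReal.rpow_add _ _ h0 hfin, add_comm, one_div, one_div, hpp'.inv_add_inv_eq_one,
          ENNReal.rpow_one]
      refine (ENNReal.mul_le_mul_iff_left ?_ ?_).1 (hsplit.symm.le.trans h3)
      · simp [h0, hfin]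
      · exact ENNReal.rpow_ne_top_of_nonneg (one_div_nonneg.2 hp0.le) hfin
    calc I = (I ^ (1 / p')) ^ p' := by
          rw [← ENNReal.rpow_mul, one_div_mul_cancel hp'0.ne', ENNReal.rpow_one]
      _ ≤ C ^ p' := ENNReal.rpow_le_rpow hI hp'0.le
  have hmono : Monotone F := by
    intro N N' hNN' y
    refine Set.indicator_le_indicator_of_subset (fun z hz => ?_) (fun _ => zero_le) y
    have : (N : ℝ≥0) ≤ N' := by exact_mod_cast hNN'
    exact ⟨hz.1.trans this, hz.2.trans this⟩
  have hle : ∫⁻ y, (k y : ℝ≥0∞) ^ p' ∂μ ≤ C ^ p' := by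
    calc ∫⁻ y, (k y : ℝ≥0∞) ^ p' ∂μ ≤ ∫⁻ y, ⨆ N, F N y ∂μ := by
          refine lintegral_mono fun y => ?_
          obtain ⟨N, hN⟩ := exists_nat_ge (max (k y) (s y))
          refine le_iSup_of_le N ?_
          have hy : y ∈ E N := ⟨(le_max_left _ _).trans hN, (le_max_right _ _).trans hN⟩
          simp only [F, Set.indicator_of_mem hy, le_refl]
      _ = ⨆ N, ∫⁻ y, F N y ∂μ := lintegral_iSup' hF (Filter.Eventually.of_forall fun y a b hab =>
          hmono hab y)
      _ ≤ C ^ p' := iSup_le hbound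
  calc _ ≤ (C ^ p') ^ (1 / p') := ENNReal.rpow_le_rpow hle (one_div_nonneg.2 hp'0.le)
    _ = C := by rw [← ENNReal.rpow_mul, mul_one_div_cancel hp'0.ne', ENNReal.rpow_one]

end Duality

section Operators

variable {n : ℕ}

lemma enorm_clm_le_sum_enorm_apply_single (L : Cn n →L[ℂ] Cn n) :
    ‖L‖ₑ ≤ ∑ j, ‖L (EuclideanSpace.single j 1)‖ₑ := by
  have h : ‖L‖ ≤ ∑ j, ‖L (EuclideanSpace.single j 1)‖ := by
    refine L.opNorm_le_bound (Finset.sum_nonneg fun _ _ => norm_nonneg _) fun v => ?_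
    have hv : v = ∑ j, v j • EuclideanSpace.single j (1 : ℂ) := by
      ext i
      simp [Finset.sum_apply, Pi.single_apply]
    calc ‖L v‖ = ‖∑ j, v j • L (EuclideanSpace.single j 1)‖ := by
          conv_lhs => rw [hv, map_sum]
          simp only [map_smul]
      _ ≤ ∑ j, ‖v j • L (EuclideanSpace.single j 1)‖ := norm_sum_le _ _
      _ ≤ ∑ j, ‖v‖ * ‖L (EuclideanSpace.single j 1)‖ := by
          refine Finset.sum_le_sum fun j _ => ?_
          rw [norm_smul]
          exact mul_le_mul_of_nonneg_right (PiLp.norm_apply_le v j) (norm_nonneg _)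
      _ = _ := by rw [← Finset.mul_sum, mul_comm]
  calc ‖L‖ₑ = ENNReal.ofReal ‖L‖ := (ofReal_norm L).symm
    _ ≤ ENNReal.ofReal (∑ j, ‖L (EuclideanSpace.single j 1)‖) := ENNReal.ofReal_le_ofReal h
    _ = _ := by
      rw [ENNReal.ofReal_sum_of_nonneg fun _ _ => norm_nonneg _]
      simp only [ofReal_norm]

lemma enorm_le_sum_enorm_coord (v : Cn n) : ‖v‖ₑ ≤ ∑ i, ‖v i‖ₑ := by
  have hv : v = ∑ j, EuclideanSpace.single j (v j) := by
    ext i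
    simp [Finset.sum_apply, Pi.single_apply]
  conv_lhs => rw [hv]
  refine (enorm_sum_le _ _).trans (Finset.sum_le_sum fun i _ => le_of_eq ?_)
  rw [← ofReal_norm, PiLp.norm_single, ofReal_norm]

lemma enorm_coord_le (v : Cn n) (i : Fin n) : ‖v i‖ₑ ≤ ‖v‖ₑ := by
  rw [← ofReal_norm, ← ofReal_norm]
  exact ENNReal.ofReal_le_ofReal (PiLp.norm_apply_le v i)

lemma enorm_apply_single_le (L : Cn n →L[ℂ] Cn n) (j : Fin n) :
    ‖L (EuclideanSpace.single j 1)‖ₑ ≤ ‖L‖ₑ := by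
  rw [← ofReal_norm, ← ofReal_norm]
  exact ENNReal.ofReal_le_ofReal (by simpa using L.le_opNorm (EuclideanSpace.single j 1))

/-- A quantity `∑ a j ^ r` dominates `‖L‖ ^ r`, where `a j` are the norms of the columns of `L`. -/
lemma enorm_clm_rpow_le (L : Cn n →L[ℂ] Cn n) {r : ℝ} (hr : 0 < r) :
    ‖L‖ₑ ^ r ≤ (n : ℝ≥0∞) ^ r * ∑ j, ‖L (EuclideanSpace.single j 1)‖ₑ ^ r := by
  have h := enorm_clm_le_sum_enorm_apply_single L
  obtain h0 | hn := (Finset.univ : Finset (Fin n)).eq_empty_or_nonempty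
  · have : IsEmpty (Fin n) := Finset.univ_eq_empty_iff.1 h0
    simp only [h0, Finset.sum_empty, nonpos_iff_eq_zero] at h
    simp [h, hr]
  obtain ⟨j, -, hj⟩ := Finset.exists_max_image Finset.univ
    (fun j => ‖L (EuclideanSpace.single j 1)‖ₑ) hn
  calc ‖L‖ₑ ^ r ≤ (n * ‖L (EuclideanSpace.single j 1)‖ₑ) ^ r := by
        refine ENNReal.rpow_le_rpow (h.trans ?_) hr.le
        simpa using Finset.sum_le_card_nsmul Finset.univ _ _ hj
    _ = (n : ℝ≥0∞) ^ r * ‖L (EuclideanSpace.single j 1)‖ₑ ^ r := ENNReal.mul_rpow_of_nonneg _ _ hr.le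
    _ ≤ _ := by
        gcongr
        exact Finset.single_le_sum (f := fun j => ‖L (EuclideanSpace.single j 1)‖ₑ ^ r)
          (fun _ _ => zero_le) (Finset.mem_univ j)

variable {X Y : Type*} [MeasurableSpace X] [MeasurableSpace Y] {ν : Measure X} {μ : Measure Y}

/-- If `M` is controlled by the `L^q` mean of a field `T`, then the `L^{p'}` norm of `M ∘ S` is
controlled by the mixed norm of `T x ∘ S y`. -/
lemma lintegral_enorm_comp_rpow_le [IsFiniteMeasure μ] {p p' q : ℝ} (hpp' : p.HolderConjugate p')
    (hq : 0 < q) {T : X → Cn n →L[ℂ] Cn n} {S : Y → Cn n →L[ℂ] Cn n}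
    (hS : AEStronglyMeasurable S μ) {M : Cn n →L[ℂ] Cn n} {c : ℝ≥0∞}
    (hM : ∀ e, ‖M e‖ₑ ≤ c * (∫⁻ x, ‖T x e‖ₑ ^ q ∂ν) ^ (1 / q)) :
    (∫⁻ y, ‖M ∘L S y‖ₑ ^ p' ∂μ) ^ (1 / p') ≤
      (n : ℝ≥0∞) ^ 2 *
        (c * (∫⁻ x, (∫⁻ y, ‖T x ∘L S y‖ₑ ^ p' ∂μ) ^ (q / p') ∂ν) ^ (1 / q)) := by
  have hp0 : 0 < p := hpp'.pos
  have hp'0 : 0 < p' := hpp'.symm.pos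
  have hcomp : ∀ L : Cn n →L[ℂ] Cn n, AEStronglyMeasurable (fun y => L ∘L S y) μ := fun L =>
    (ContinuousLinearMap.compL ℂ (Cn n) (Cn n) (Cn n) L).continuous.comp_aestronglyMeasurable hS
  set A : ℝ≥0∞ := c * (∫⁻ x, (∫⁻ y, ‖T x ∘L S y‖ₑ ^ p' ∂μ) ^ (q / p') ∂ν) ^ (1 / q)
  refine lintegral_rpow_le_of_forall_lintegral_mul_le (k := fun y => ‖M ∘L S y‖₊)
    (s := fun y => ‖S y‖₊) hpp' (hcomp M).nnnorm.aemeasurable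
    hS.nnnorm.aemeasurable fun h hh => ?_
  rintro ⟨N, hN⟩
  set b : ℝ≥0∞ := (∫⁻ y, (h y : ℝ≥0∞) ^ p ∂μ) ^ (1 / p)
  have hb : b ≠ ⊤ := by
    refine ENNReal.rpow_ne_top_of_nonneg (one_div_nonneg.2 hp0.le) ?_
    refine ne_top_of_le_ne_top (b := ∫⁻ _, (N : ℝ≥0∞) ^ p ∂μ) ?_ (lintegral_mono fun y => ?_)
    · rw [lintegral_const]
      exact ENNReal.mul_ne_top (ENNReal.rpow_ne_top_of_nonneg hp0.le (by simp))
        (measure_ne_top _ _)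
    · exact ENNReal.rpow_le_rpow (by exact_mod_cast (hN y).1) hp0.le
  have hSv : ∀ v : Cn n, AEStronglyMeasurable (fun y => S y v) μ := fun v =>
    (ContinuousLinearMap.apply ℂ (Cn n) v).continuous.comp_aestronglyMeasurable hS
  have hcoord : ∀ i j : Fin n,
      ∫⁻ y, ‖(M (S y (EuclideanSpace.single j 1))) i‖ₑ * h y ∂μ ≤ A * b := by
    intro i j
    set v : Cn n := EuclideanSpace.single j 1
    have hv : ‖v‖ = 1 := by simp [v]
    set φ : Y → ℂ := fun y => (M (S y v)) i with hφ
    have hφm : AEStronglyMeasurable φ μ :=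
      (EuclideanSpace.proj (𝕜 := ℂ) i ∘L M).continuous.comp_aestronglyMeasurable (hSv v)
    set g : Y → ℂ := fun y => (h y : ℂ) * (starRingEnd ℂ (φ y) / (‖φ y‖ : ℂ)) with hg
    have hgm : AEMeasurable g μ := by
      have h1 : AEMeasurable (fun y => ((h y : ℝ) : ℂ)) μ :=
        Complex.measurable_ofReal.comp_aemeasurable hh.coe_nnreal_real
      have h2 : AEMeasurable (fun y => starRingEnd ℂ (φ y)) μ :=
        (Complex.continuous_conj.comp_aestronglyMeasurable hφm).aemeasurable
      have h3 : AEMeasurable (fun y => ((‖φ y‖ : ℝ) : ℂ)) μ :=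
        Complex.measurable_ofReal.comp_aemeasurable hφm.norm.aemeasurable
      exact h1.mul (h2.div h3)
    have hgle : ∀ y, ‖g y‖ ≤ h y := by
      intro y
      simp only [hg, norm_mul, norm_div, RCLike.norm_conj, Complex.norm_real, norm_norm]
      rw [Real.norm_of_nonneg (h y).coe_nonneg]
      exact mul_le_of_le_one_right (h y).coe_nonneg (div_self_le_one _)
    have hgφ : ∀ y, g y * φ y = ((‖φ y‖ * h y : ℝ) : ℂ) := by
      intro y
      by_cases h0 : φ y = 0
      · simp [h0]
      · have h1 : (‖φ y‖ : ℂ) ≠ 0 := by simpa using h0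
        simp only [hg]
        rw [mul_assoc, div_mul_eq_mul_div, Complex.conj_mul']
        push_cast
        field_simp
    have hgS : Integrable (fun y => g y • S y v) μ := by
      refine Integrable.of_bound (hgm.aestronglyMeasurable.smul (hSv v)) N
        (Filter.Eventually.of_forall fun y => ?_)
      rw [norm_smul]
      calc ‖g y‖ * ‖S y v‖ ≤ h y * ‖S y‖ := by
            refine mul_le_mul (hgle y) ?_ (norm_nonneg _) (h y).coe_nonneg
            simpa [hv] using (S y).le_opNorm v
        _ ≤ N := by exact_mod_cast (hN y).2
    set w : Cn n := ∫ y, g y • S y v ∂μ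
    have hMw : (M w) i = ∫ y, ((‖φ y‖ * h y : ℝ) : ℂ) ∂μ := by
      have := ((EuclideanSpace.proj (𝕜 := ℂ) i ∘L M).integral_comp_comm hgS).symm
      simp only [map_smul, smul_eq_mul] at this
      exact this.trans (integral_congr_ae (Filter.Eventually.of_forall hgφ))
    have hreal : ∫⁻ y, ‖φ y‖ₑ * h y ∂μ = ‖(M w) i‖ₑ := by
      have hnonneg : ∀ y, 0 ≤ ‖φ y‖ * h y := fun y => by positivity
      have hi : Integrable (fun y => ‖φ y‖ * (h y : ℝ)) μ := by
        have := ((EuclideanSpace.proj (𝕜 := ℂ) i ∘L M).integrable_comp hgS).norm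
        refine this.congr (Filter.Eventually.of_forall fun y => ?_)
        have h2 := congrArg norm (hgφ y)
        rw [Complex.norm_real, Real.norm_of_nonneg (hnonneg y)] at h2
        beta_reduce
        rw [← h2, map_smul]
        rfl
      rw [hMw, integral_complex_ofReal, ← ofReal_norm, Complex.norm_real, Real.norm_eq_abs,
        abs_of_nonneg (integral_nonneg hnonneg),
        ofReal_integral_eq_lintegral_ofReal hi (Filter.Eventually.of_forall hnonneg)]
      refine lintegral_congr fun y => ?_
      rw [ENNReal.ofReal_mul (norm_nonneg _), ofReal_norm, ENNReal.ofReal_coe_nnreal]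
    have hTw : ∀ x, ‖T x w‖ₑ ≤ (∫⁻ y, ‖T x ∘L S y‖ₑ ^ p' ∂μ) ^ (1 / p') * b := by
      intro x
      calc ‖T x w‖ₑ = ‖∫ y, T x (g y • S y v) ∂μ‖ₑ := by
            rw [(T x).integral_comp_comm hgS]
        _ ≤ ∫⁻ y, ‖T x (g y • S y v)‖ₑ ∂μ := enorm_integral_le_lintegral_enorm _
        _ ≤ ∫⁻ y, ‖T x ∘L S y‖ₑ * h y ∂μ := by
            refine lintegral_mono fun y => ?_
            rw [map_smul, enorm_smul, mul_comm]
            refine mul_le_mul' (enorm_apply_single_le (T x ∘L S y) j) ?_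
            rw [← ofReal_norm, ← ENNReal.ofReal_coe_nnreal]
            exact ENNReal.ofReal_le_ofReal (hgle y)
        _ ≤ _ := lintegral_mul_le_of_aemeasurable_left hpp' (hcomp (T x)).enorm
            fun y => enorm_ne_top
    calc ∫⁻ y, ‖φ y‖ₑ * h y ∂μ = ‖(M w) i‖ₑ := hreal
      _ ≤ ‖M w‖ₑ := enorm_coord_le _ i
      _ ≤ c * (∫⁻ x, ‖T x w‖ₑ ^ q ∂ν) ^ (1 / q) := hM w
      _ ≤ c * (∫⁻ x, ((∫⁻ y, ‖T x ∘L S y‖ₑ ^ p' ∂μ) ^ (1 / p') * b) ^ q ∂ν) ^ (1 / q) := by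
          gcongr with x
          exact hTw x
      _ = A * b := by
          have : ∀ x, ((∫⁻ y, ‖T x ∘L S y‖ₑ ^ p' ∂μ) ^ (1 / p') * b) ^ q =
              (∫⁻ y, ‖T x ∘L S y‖ₑ ^ p' ∂μ) ^ (q / p') * b ^ q := fun x => by
            rw [ENNReal.mul_rpow_of_nonneg _ _ hq.le, ← ENNReal.rpow_mul, one_div_mul_eq_div]
          simp_rw [this]
          rw [lintegral_mul_const' _ _ (ENNReal.rpow_ne_top_of_nonneg hq.le hb),
            ENNReal.mul_rpow_of_nonneg _ _ (one_div_nonneg.2 hq.le), ← ENNReal.rpow_mul b,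
            mul_one_div_cancel hq.ne', ENNReal.rpow_one, ← mul_assoc]
  calc ∫⁻ y, (‖M ∘L S y‖₊ : ℝ≥0∞) * h y ∂μ
      ≤ ∫⁻ y, ∑ j, ∑ i, ‖(M (S y (EuclideanSpace.single j 1))) i‖ₑ * h y ∂μ := by
        refine lintegral_mono fun y => ?_
        simp_rw [← Finset.sum_mul]
        gcongr
        refine (enorm_clm_le_sum_enorm_apply_single (M ∘L S y)).trans
          (Finset.sum_le_sum fun j _ => ?_)
        exact enorm_le_sum_enorm_coord _
    _ = ∑ j, ∑ i, ∫⁻ y, ‖(M (S y (EuclideanSpace.single j 1))) i‖ₑ * h y ∂μ := by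
        have hm : ∀ i j : Fin n, AEMeasurable
            (fun y => ‖(M (S y (EuclideanSpace.single j 1))) i‖ₑ * (h y : ℝ≥0∞)) μ := fun i j =>
          ((EuclideanSpace.proj (𝕜 := ℂ) i ∘L M).continuous.comp_aestronglyMeasurable
            (hSv _)).enorm.mul hh.coe_nnreal_ennreal
        rw [lintegral_finsetSum' _ fun j _ => Finset.aemeasurable_fun_sum _ fun i _ => hm i j]
        exact Finset.sum_congr rfl fun j _ => lintegral_finsetSum' _ fun i _ => hm i j
    _ ≤ ∑ _j : Fin n, ∑ _i : Fin n, A * b :=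
        Finset.sum_le_sum fun j _ => Finset.sum_le_sum fun i _ => hcoord i j
    _ = _ := by simp [sq, mul_assoc]

end Operators

namespace Cube

variable {d : ℕ}

lemma vol_pos (Q : Cube d) : 0 < Q.vol := pow_pos Q.side_pos d

lemma set_eq_preimage (Q : Cube d) :
    Q.set = (MeasurableEquiv.toLp 2 (Fin d → ℝ)).symm ⁻¹'
      Set.pi Set.univ fun i => Set.Ico (Q.corner i) (Q.corner i + Q.side) := by
  ext x
  simp [Cube.set]

lemma measurableSet_set (Q : Cube d) : MeasurableSet Q.set := by
  rw [Q.set_eq_preimage]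
  exact (MeasurableEquiv.measurable _) (MeasurableSet.univ_pi fun i => measurableSet_Ico)

lemma volume_set (Q : Cube d) : volume Q.set = ENNReal.ofReal Q.vol := by
  rw [Q.set_eq_preimage, (EuclideanSpace.volume_preserving_symm_measurableEquiv_toLp
    (Fin d)).measure_preimage_equiv, Real.volume_pi_Ico]
  simp [Cube.vol, ENNReal.ofReal_pow Q.side_pos.le]

/-- The concentric cube with five times the side length. -/
def fivefold (Q : Cube d) : Cube d :=
  ⟨fun i => Q.corner i - 2 * Q.side, 5 * Q.side, by linarith [Q.side_pos]⟩

lemma volume_fivefold (Q : Cube d) : volume Q.fivefold.set = 5 ^ d * ENNReal.ofReal Q.vol := by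
  rw [volume_set, vol, fivefold, vol, mul_pow, ENNReal.ofReal_mul (by positivity)]
  congr 1
  rw [ENNReal.ofReal_pow (by norm_num)]
  norm_num

lemma subset_fivefold {Q R : Cube d} (h : (Q.set ∩ R.set).Nonempty) (hs : Q.side ≤ 2 * R.side) :
    Q.set ⊆ R.fivefold.set := by
  obtain ⟨z, hzQ, hzR⟩ := h
  intro x hx i
  have h1 := hzQ i
  have h2 := hzR i
  have h3 := hx i
  simp only [fivefold]
  constructor <;> linarith [R.side_pos]

end Cube

lemma ENNReal.tsum_rpow_le_rpow_tsum {ι : Type*} (x : ι → ℝ≥0∞) {s : ℝ} (hs : 1 ≤ s) :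
    ∑' i, x i ^ s ≤ (∑' i, x i) ^ s := by
  have hsplit : ∀ a : ℝ≥0∞, a ^ s = a * a ^ (s - 1) := fun a => by
    conv_rhs => enter [1]; rw [← ENNReal.rpow_one a]
    rw [← ENNReal.rpow_add_of_nonneg _ _ zero_le_one (sub_nonneg.2 hs)]
    congr 1; ring
  calc ∑' i, x i ^ s ≤ ∑' i, x i * (∑' i, x i) ^ (s - 1) := by
        refine ENNReal.tsum_le_tsum fun i => ?_
        rw [hsplit]
        exact mul_le_mul' le_rfl (ENNReal.rpow_le_rpow (ENNReal.le_tsum i) (sub_nonneg.2 hs))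
    _ = _ := by rw [ENNReal.tsum_mul_right, ← hsplit]

/-- The weak type inequality for a maximal function whose averages are controlled by the
`L^p` norm on each cube, with the scaling of `L^q`. -/
lemma weak_type_of_forall_cube {d : ℕ} (hd : d ≠ 0) {p q : ℝ} (hp : 0 < p) (hpq : p ≤ q)
    {a : Cube d → ℝ≥0∞} {F : Rd d → ℝ≥0∞} {K : ℝ≥0∞} (hK0 : K ≠ 0) (hK : K ≠ ⊤)
    (h : ∀ Q : Cube d, ENNReal.ofReal Q.vol ^ (1 / q) * a Q ≤ K * (∫⁻ x in Q.set, F x) ^ (1 / p))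
    {lam : ℝ} (hlam : 0 < lam) :
    ENNReal.ofReal lam *
        volume {x : Rd d | ENNReal.ofReal lam < ⨆ (Q : Cube d) (_ : x ∈ Q.set), a Q} ^ (1 / q) ≤
      (5 ^ d) ^ (1 / q) * K * (∫⁻ x, F x) ^ (1 / p) := by
  have hq : 0 < q := hp.trans_le hpq
  set I := ∫⁻ x, F x
  set l := ENNReal.ofReal lam
  have hl0 : l ≠ 0 := by simpa [l] using hlam
  have hl : l ≠ ⊤ := ENNReal.ofReal_ne_top
  by_cases hI : I = ⊤
  · rw [hI, ENNReal.top_rpow_of_pos (one_div_pos.2 hp), ENNReal.mul_top]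
    · exact le_top
    · exact mul_ne_zero (by simp) hK0
  set t : Set (Cube d) := {Q | l < a Q}
  have hvol : ∀ Q ∈ t, l ^ q * ENNReal.ofReal Q.vol ≤ K ^ q * (∫⁻ x in Q.set, F x) ^ (q / p) := by
    intro Q hQ
    have h1 : ENNReal.ofReal Q.vol ^ (1 / q) * l ≤ K * (∫⁻ x in Q.set, F x) ^ (1 / p) :=
      le_trans (by gcongr; exact (show l < a Q from hQ).le) (h Q)
    have h2 := ENNReal.rpow_le_rpow h1 hq.le
    rwa [ENNReal.mul_rpow_of_nonneg _ _ hq.le, ENNReal.mul_rpow_of_nonneg _ _ hq.le,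
      ← ENNReal.rpow_mul, ← ENNReal.rpow_mul, one_div_mul_cancel hq.ne', ENNReal.rpow_one,
      one_div_mul_eq_div, mul_comm] at h2
  have hlq0 : l ^ q ≠ 0 := by simp [hl0, hl]
  have hlq : l ^ q ≠ ⊤ := ENNReal.rpow_ne_top_of_nonneg hq.le hl
  set R0 : ℝ≥0∞ := K ^ q * I ^ (q / p) / l ^ q
  have hR0 : R0 ≠ ⊤ := ENNReal.div_ne_top (ENNReal.mul_ne_top
    (ENNReal.rpow_ne_top_of_nonneg hq.le hK)
    (ENNReal.rpow_ne_top_of_nonneg (by positivity) hI)) hlq0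
  have hside : ∀ Q ∈ t, Q.side ≤ max 1 R0.toReal := by
    intro Q hQ
    have h1 : ENNReal.ofReal Q.vol ≤ R0 := by
      rw [ENNReal.le_div_iff_mul_le (Or.inl hlq0) (Or.inl hlq), mul_comm]
      refine (hvol Q hQ).trans ?_
      exact mul_le_mul' le_rfl
        (ENNReal.rpow_le_rpow (setLIntegral_le_lintegral _ _) (by positivity))
    have h2 : Q.side ^ d ≤ R0.toReal := (ENNReal.ofReal_le_iff_le_toReal hR0).1 h1
    rcases le_total Q.side 1 with h3 | h3
    · exact h3.trans (le_max_left _ _)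
    · exact (le_self_pow₀ h3 hd).trans (h2.trans (le_max_right _ _))
  obtain ⟨u, hut, hdisj, hcov⟩ := Vitali.exists_disjoint_subfamily_covering_enlargement
    (fun Q : Cube d => Q.set) t Cube.side 2 one_lt_two (fun Q _ => Q.side_pos.le) _ hside
    fun Q _ => nonempty_of_measure_ne_zero (μ := volume) (by
      rw [Q.volume_set]; simpa using Q.vol_pos)
  have hdisj' : Pairwise (Function.onFun Disjoint fun b : u => (b : Cube d).set) :=
    fun b c hbc => hdisj b.2 c.2 (Subtype.coe_injective.ne hbc)
  have hcount : Countable u := by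
    have h1 := Measure.countable_meas_pos_of_disjoint_iUnion (μ := (volume : Measure (Rd d)))
      (fun b : u => (b : Cube d).measurableSet_set) hdisj'
    have h2 : {b : u | 0 < volume (b : Cube d).set} = Set.univ := by
      refine Set.eq_univ_of_forall fun b => ?_
      simp only [Set.mem_ofPred_eq, Cube.volume_set]
      simpa using (b : Cube d).vol_pos
    rw [h2] at h1
    exact Set.countable_univ_iff.1 h1
  set E := {x : Rd d | l < ⨆ (Q : Cube d) (_ : x ∈ Q.set), a Q}
  have hE : E ⊆ ⋃ b : u, (b : Cube d).fivefold.set := by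
    intro x hx
    obtain ⟨Q, hQ⟩ := lt_iSup_iff.1 (show l < _ from hx)
    obtain ⟨hxQ, hQ⟩ := lt_iSup_iff.1 hQ
    obtain ⟨b, hb, hne, hs⟩ := hcov Q hQ
    exact Set.mem_iUnion.2 ⟨⟨b, hb⟩, Cube.subset_fivefold hne hs hxQ⟩
  have hmain : l ^ q * volume E ≤ 5 ^ d * (K ^ q * I ^ (q / p)) := by
    calc l ^ q * volume E ≤ l ^ q * ∑' b : u, volume (b : Cube d).fivefold.set := by
          gcongr
          exact (measure_mono hE).trans (measure_iUnion_le _)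
      _ = 5 ^ d * ∑' b : u, l ^ q * ENNReal.ofReal (b : Cube d).vol := by
          simp_rw [Cube.volume_fivefold, ENNReal.tsum_mul_left]
          ring
      _ ≤ 5 ^ d * ∑' b : u, K ^ q * (∫⁻ x in (b : Cube d).set, F x) ^ (q / p) := by
          exact mul_le_mul' le_rfl (ENNReal.tsum_le_tsum fun b => hvol b (hut b.2))
      _ ≤ 5 ^ d * (K ^ q * (∑' b : u, ∫⁻ x in (b : Cube d).set, F x) ^ (q / p)) := by
          rw [ENNReal.tsum_mul_left]
          gcongr
          exact ENNReal.tsum_rpow_le_rpow_tsum _ ((one_le_div hp).2 hpq)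
      _ ≤ 5 ^ d * (K ^ q * I ^ (q / p)) := by
          gcongr
          rw [← lintegral_iUnion (fun b : u => (b : Cube d).measurableSet_set) hdisj']
          exact setLIntegral_le_lintegral _ _
  have hfin := ENNReal.rpow_le_rpow hmain (one_div_nonneg.2 hq.le)
  rw [ENNReal.mul_rpow_of_nonneg _ _ (one_div_nonneg.2 hq.le),
    ENNReal.mul_rpow_of_nonneg _ _ (one_div_nonneg.2 hq.le),
    ENNReal.mul_rpow_of_nonneg _ _ (one_div_nonneg.2 hq.le), ← ENNReal.rpow_mul l,
    ← ENNReal.rpow_mul K, ← ENNReal.rpow_mul I, mul_one_div_cancel hq.ne', ENNReal.rpow_one,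
    ENNReal.rpow_one, div_mul_div_comm, mul_one, mul_comm p q, ← div_div, div_self hq.ne',
    ← mul_assoc] at hfin
  exact hfin

namespace Cube

variable {d : ℕ}

/-- The normalized Lebesgue measure of a cube. -/
def avgMeasure (Q : Cube d) : Measure (Rd d) :=
  (ENNReal.ofReal Q.vol)⁻¹ • volume.restrict Q.set

lemma ofReal_vol_ne_zero (Q : Cube d) : ENNReal.ofReal Q.vol ≠ 0 := by simpa using Q.vol_pos

lemma lintegral_avgMeasure (Q : Cube d) (f : Rd d → ℝ≥0∞) :
    ∫⁻ x, f x ∂Q.avgMeasure = (ENNReal.ofReal Q.vol)⁻¹ * ∫⁻ x in Q.set, f x := by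
  rw [avgMeasure, lintegral_smul_measure, smul_eq_mul]

lemma setLIntegral_eq_mul_lintegral_avgMeasure (Q : Cube d) (f : Rd d → ℝ≥0∞) :
    ∫⁻ x in Q.set, f x = ENNReal.ofReal Q.vol * ∫⁻ x, f x ∂Q.avgMeasure := by
  rw [lintegral_avgMeasure, ← mul_assoc,
    ENNReal.mul_inv_cancel Q.ofReal_vol_ne_zero ENNReal.ofReal_ne_top, one_mul]

lemma avgMeasure_univ (Q : Cube d) : Q.avgMeasure Set.univ = 1 := by
  rw [avgMeasure, Measure.smul_apply, Measure.restrict_apply_univ, volume_set, smul_eq_mul,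
    ENNReal.inv_mul_cancel Q.ofReal_vol_ne_zero ENNReal.ofReal_ne_top]

instance (Q : Cube d) : IsProbabilityMeasure Q.avgMeasure := ⟨Q.avgMeasure_univ⟩

lemma avgMeasure_absolutelyContinuous (Q : Cube d) : Q.avgMeasure ≪ volume :=
  Measure.AbsolutelyContinuous.trans Measure.smul_absolutelyContinuous
    Measure.absolutelyContinuous_restrict

lemma ae_avgMeasure_iff (Q : Cube d) {P : Rd d → Prop} :
    (∀ᵐ x ∂Q.avgMeasure, P x) ↔ ∀ᵐ x ∂(volume.restrict Q.set), P x := by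
  rw [avgMeasure, Measure.ae_ennreal_smul_measure_iff (by simp)]

lemma ofReal_vol_rpow_add (Q : Cube d) (r s : ℝ) :
    ENNReal.ofReal Q.vol ^ (r + s) = ENNReal.ofReal Q.vol ^ r * ENNReal.ofReal Q.vol ^ s :=
  ENNReal.rpow_add _ _ Q.ofReal_vol_ne_zero ENNReal.ofReal_ne_top

/-- Comparison of `L^p` norms for the normalized and the Lebesgue measure on a cube. -/
lemma lintegral_avgMeasure_rpow (Q : Cube d) (f : Rd d → ℝ≥0∞) {r : ℝ} (hr : 0 ≤ r) :
    (∫⁻ x, f x ∂Q.avgMeasure) ^ r =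
      ENNReal.ofReal Q.vol ^ (-r) * (∫⁻ x in Q.set, f x) ^ r := by
  rw [lintegral_avgMeasure, ENNReal.mul_rpow_of_nonneg _ _ hr, ENNReal.inv_rpow, ENNReal.rpow_neg]

lemma setLIntegral_rpow (Q : Cube d) (f : Rd d → ℝ≥0∞) {r : ℝ} (hr : 0 ≤ r) :
    (∫⁻ x in Q.set, f x) ^ r =
      ENNReal.ofReal Q.vol ^ r * (∫⁻ x, f x ∂Q.avgMeasure) ^ r := by
  rw [setLIntegral_eq_mul_lintegral_avgMeasure, ENNReal.mul_rpow_of_nonneg _ _ hr]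

end Cube

/-- A matrix as an operator on `ℂ^n`. -/
abbrev toOp {n : ℕ} (A : Mat n) : Cn n →L[ℂ] Cn n := Matrix.toEuclideanCLM (𝕜 := ℂ) A

lemma ofReal_opNorm_mul {n : ℕ} (A B : Mat n) :
    ENNReal.ofReal (opNorm (A * B)) = ‖toOp A ∘L toOp B‖ₑ := by
  rw [opNorm, map_mul, ofReal_norm]
  rfl

section CubeEstimates

variable {d n : ℕ} {Q : Cube d} {p p' q β : ℝ} {T S : Rd d → Cn n →L[ℂ] Cn n}
  {M : Cn n →L[ℂ] Cn n} {c : ℝ≥0∞}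

lemma enorm_comp_apply_le (L : Cn n →L[ℂ] Cn n) (v : Cn n) : ‖L v‖ₑ ≤ ‖L‖ₑ * ‖v‖ₑ := by
  rw [← ofReal_norm, ← ofReal_norm, ← ofReal_norm, ← ENNReal.ofReal_mul (norm_nonneg _)]
  exact ENNReal.ofReal_le_ofReal (L.le_opNorm v)

lemma enorm_comp_le (L L' : Cn n →L[ℂ] Cn n) : ‖L ∘L L'‖ₑ ≤ ‖L‖ₑ * ‖L'‖ₑ := by
  rw [← ofReal_norm, ← ofReal_norm, ← ofReal_norm, ← ENNReal.ofReal_mul (norm_nonneg _)]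
  exact ENNReal.ofReal_le_ofReal (L.opNorm_comp_le L')

lemma aestronglyMeasurable_comp_left {X : Type*} [MeasurableSpace X] {μ : Measure X}
    {S : X → Cn n →L[ℂ] Cn n} (hS : AEStronglyMeasurable S μ) (L : Cn n →L[ℂ] Cn n) :
    AEStronglyMeasurable (fun y => L ∘L S y) μ :=
  (ContinuousLinearMap.compL ℂ (Cn n) (Cn n) (Cn n) L).continuous.comp_aestronglyMeasurable hS

lemma aestronglyMeasurable_apply {X : Type*} [MeasurableSpace X] {μ : Measure X}
    {S : X → Cn n →L[ℂ] Cn n} (hS : AEStronglyMeasurable S μ) (v : Cn n) :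
    AEStronglyMeasurable (fun y => S y v) μ :=
  (ContinuousLinearMap.apply ℂ (Cn n) v).continuous.comp_aestronglyMeasurable hS

lemma average_le_of_one_lt (hpp' : p.HolderConjugate p') (hq : 0 < q)
    (hS : AEStronglyMeasurable S volume)
    (hM : ∀ e, ‖M e‖ₑ ≤ c * (∫⁻ x, ‖T x e‖ₑ ^ q ∂Q.avgMeasure) ^ (1 / q)) (f : Rd d → Cn n) :
    ENNReal.ofReal Q.vol ^ (1 / q) *
        (ENNReal.ofReal Q.vol ^ β * ∫⁻ y, ‖(M ∘L S y) (f y)‖ₑ ∂Q.avgMeasure) ≤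
      (n : ℝ≥0∞) ^ 2 * c *
        (ENNReal.ofReal Q.vol ^ (β + 1 / q - 1 / p) *
          (∫⁻ x, (∫⁻ y, ‖T x ∘L S y‖ₑ ^ p' ∂Q.avgMeasure) ^ (q / p') ∂Q.avgMeasure) ^ (1 / q)) *
        (∫⁻ y in Q.set, ‖f y‖ₑ ^ p) ^ (1 / p) := by
  have hS' := hS.mono_ac Q.avgMeasure_absolutelyContinuous
  have h1 : ∫⁻ y, ‖(M ∘L S y) (f y)‖ₑ ∂Q.avgMeasure ≤
      (∫⁻ y, ‖M ∘L S y‖ₑ ^ p' ∂Q.avgMeasure) ^ (1 / p') *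
        (∫⁻ y, ‖f y‖ₑ ^ p ∂Q.avgMeasure) ^ (1 / p) :=
    (lintegral_mono fun y => enorm_comp_apply_le _ _).trans
      (lintegral_mul_le_of_aemeasurable_left hpp' (aestronglyMeasurable_comp_left hS' M).enorm
        fun y => enorm_ne_top)
  have h2 := lintegral_enorm_comp_rpow_le hpp' hq hS' hM
  rw [Q.lintegral_avgMeasure_rpow _ (one_div_nonneg.2 hpp'.nonneg)] at h1
  rw [sub_eq_add_neg, Q.ofReal_vol_rpow_add, Q.ofReal_vol_rpow_add]
  refine (mul_le_mul' le_rfl (mul_le_mul' le_rfl (h1.trans (mul_le_mul' h2 le_rfl)))).trans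
    (le_of_eq ?_)
  ring

lemma average_le_of_eq_one (hq : 0 < q)
    (hM : ∀ e, ‖M e‖ₑ ≤ c * (∫⁻ x, ‖T x e‖ₑ ^ q ∂Q.avgMeasure) ^ (1 / q))
    {A : ℝ≥0∞} (hA : A ≠ ⊤) (hc : c ≠ ⊤)
    (hAS : ∀ᵐ y ∂Q.avgMeasure, ENNReal.ofReal Q.vol ^ (β + 1 / q - 1) *
      (∫⁻ x, ‖T x ∘L S y‖ₑ ^ q ∂Q.avgMeasure) ^ (1 / q) ≤ A) (f : Rd d → Cn n) :
    ENNReal.ofReal Q.vol ^ (1 / q) *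
        (ENNReal.ofReal Q.vol ^ β * ∫⁻ y, ‖(M ∘L S y) (f y)‖ₑ ∂Q.avgMeasure) ≤
      (n : ℝ≥0∞) ^ 2 * c * A * ∫⁻ y in Q.set, ‖f y‖ₑ := by
  have hMS : ∀ y, ‖M ∘L S y‖ₑ ≤
      (n : ℝ≥0∞) ^ 2 * c * (∫⁻ x, ‖T x ∘L S y‖ₑ ^ q ∂Q.avgMeasure) ^ (1 / q) := by
    intro y
    calc ‖M ∘L S y‖ₑ ≤ ∑ j, ‖M (S y (EuclideanSpace.single j 1))‖ₑ :=
          enorm_clm_le_sum_enorm_apply_single _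
      _ ≤ ∑ _j : Fin n, c * (∫⁻ x, ‖T x ∘L S y‖ₑ ^ q ∂Q.avgMeasure) ^ (1 / q) := by
          refine Finset.sum_le_sum fun j _ => (hM _).trans ?_
          gcongr with x
          exact enorm_apply_single_le (T x ∘L S y) j
      _ = n * c * (∫⁻ x, ‖T x ∘L S y‖ₑ ^ q ∂Q.avgMeasure) ^ (1 / q) := by simp [mul_assoc]
      _ ≤ _ := by
          gcongr
          exact_mod_cast Nat.le_self_pow two_ne_zero n
  rw [Q.setLIntegral_eq_mul_lintegral_avgMeasure, ← mul_assoc, ← mul_assoc,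
    ← lintegral_const_mul' _ _ (by finiteness [Q.ofReal_vol_ne_zero]),
    ← lintegral_const_mul' _ _ (by finiteness)]
  refine lintegral_mono_ae (hAS.mono fun y hy => ?_)
  have hv : ENNReal.ofReal Q.vol ^ (1 / q) * ENNReal.ofReal Q.vol ^ β =
      ENNReal.ofReal Q.vol ^ (β + 1 / q - 1) * ENNReal.ofReal Q.vol := by
    conv_rhs => enter [2]; rw [← ENNReal.rpow_one (ENNReal.ofReal Q.vol)]
    rw [← Q.ofReal_vol_rpow_add, ← Q.ofReal_vol_rpow_add]
    congr 1; ring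
  rw [hv]
  calc _ ≤ ENNReal.ofReal Q.vol ^ (β + 1 / q - 1) * ENNReal.ofReal Q.vol *
        ((n : ℝ≥0∞) ^ 2 * c * (∫⁻ x, ‖T x ∘L S y‖ₑ ^ q ∂Q.avgMeasure) ^ (1 / q) * ‖f y‖ₑ) := by
        gcongr
        exact (enorm_comp_apply_le _ _).trans (mul_le_mul' (hMS y) le_rfl)
    _ = (n : ℝ≥0∞) ^ 2 * c * (ENNReal.ofReal Q.vol ^ (β + 1 / q - 1) *
        (∫⁻ x, ‖T x ∘L S y‖ₑ ^ q ∂Q.avgMeasure) ^ (1 / q)) * ENNReal.ofReal Q.vol * ‖f y‖ₑ := by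
        ring
    _ ≤ _ := by gcongr

/-- Testing the averaging operator on functions `h • e_j`. -/
lemma lintegral_enorm_comp_mul_le (hp : 0 < p)
    (hS : AEStronglyMeasurable S volume) {C : ℝ≥0∞}
    (hC : ∀ f : Rd d → Cn n, ENNReal.ofReal Q.vol ^ (1 / q) *
        (ENNReal.ofReal Q.vol ^ β * ∫⁻ y, ‖(M ∘L S y) (f y)‖ₑ ∂Q.avgMeasure) ≤
      C * (∫⁻ y, ‖f y‖ₑ ^ p) ^ (1 / p)) {h : Rd d → ℝ≥0} (hh : AEMeasurable h Q.avgMeasure) :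
    ∫⁻ y, ‖M ∘L S y‖ₑ * h y ∂Q.avgMeasure ≤
      n * C * ENNReal.ofReal Q.vol ^ (-(β + 1 / q - 1 / p)) *
        (∫⁻ y, (h y : ℝ≥0∞) ^ p ∂Q.avgMeasure) ^ (1 / p) := by
  have hS' := hS.mono_ac Q.avgMeasure_absolutelyContinuous
  have hcol : ∀ j : Fin n, ∫⁻ y, ‖M (S y (EuclideanSpace.single j 1))‖ₑ * h y ∂Q.avgMeasure ≤
      C * ENNReal.ofReal Q.vol ^ (-(β + 1 / q - 1 / p)) *
        (∫⁻ y, (h y : ℝ≥0∞) ^ p ∂Q.avgMeasure) ^ (1 / p) := by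
    intro j
    set e : Cn n := EuclideanSpace.single j 1
    set f : Rd d → Cn n := Q.set.indicator fun y => ((h y : ℝ) : ℂ) • e
    have hh' : ∀ y, ‖((h y : ℝ) : ℂ)‖ₑ = h y := fun y => by
      rw [← ofReal_norm, Complex.norm_real, Real.norm_of_nonneg (h y).coe_nonneg,
        ENNReal.ofReal_coe_nnreal]
    have he : ‖e‖ₑ = 1 := by rw [← ofReal_norm]; simp [e]
    have h1 : ∫⁻ y, ‖(M ∘L S y) (f y)‖ₑ ∂Q.avgMeasure =
        ∫⁻ y, ‖M (S y e)‖ₑ * h y ∂Q.avgMeasure := by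
      rw [Q.lintegral_avgMeasure, Q.lintegral_avgMeasure]
      congr 1
      refine setLIntegral_congr_fun Q.measurableSet_set fun y hy => ?_
      simp only [f, Set.indicator_of_mem hy, map_smul, enorm_smul, hh', mul_comm]
      rfl
    have h2 : (∫⁻ y, ‖f y‖ₑ ^ p) ^ (1 / p) =
        ENNReal.ofReal Q.vol ^ (1 / p) *
          (∫⁻ y, (h y : ℝ≥0∞) ^ p ∂Q.avgMeasure) ^ (1 / p) := by
      rw [← Q.setLIntegral_rpow _ (one_div_nonneg.2 hp.le),
        ← lintegral_indicator Q.measurableSet_set]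
      congr 1
      refine lintegral_congr fun y => ?_
      by_cases hy : y ∈ Q.set
      · simp only [f, Set.indicator_of_mem hy, enorm_smul, hh', he, mul_one]
      · simp [f, hy, hp]
    have h3 := hC f
    rw [h1, h2, ← mul_assoc, ← Q.ofReal_vol_rpow_add] at h3
    calc _ = ENNReal.ofReal Q.vol ^ (-(1 / q + β)) * (ENNReal.ofReal Q.vol ^ (1 / q + β) *
          ∫⁻ y, ‖M (S y e)‖ₑ * h y ∂Q.avgMeasure) := by
          rw [← mul_assoc, ← Q.ofReal_vol_rpow_add]
          simp
      _ ≤ _ := mul_le_mul' le_rfl h3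
      _ = _ := by
          rw [show -(β + 1 / q - 1 / p) = -(1 / q + β) + 1 / p by ring, Q.ofReal_vol_rpow_add]
          ring
  calc ∫⁻ y, ‖M ∘L S y‖ₑ * h y ∂Q.avgMeasure
      ≤ ∫⁻ y, ∑ j, ‖M (S y (EuclideanSpace.single j 1))‖ₑ * h y ∂Q.avgMeasure := by
        refine lintegral_mono fun y => ?_
        rw [← Finset.sum_mul]
        gcongr
        exact enorm_clm_le_sum_enorm_apply_single (M ∘L S y)
    _ = ∑ j, ∫⁻ y, ‖M (S y (EuclideanSpace.single j 1))‖ₑ * h y ∂Q.avgMeasure :=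
        lintegral_finsetSum' _ fun j _ =>
          (M.continuous.comp_aestronglyMeasurable (aestronglyMeasurable_apply hS' _)).enorm.mul
            hh.coe_nnreal_ennreal
    _ ≤ ∑ _j : Fin n, _ := Finset.sum_le_sum fun j _ => hcol j
    _ = _ := by simp [mul_assoc]

/-- If `M` dominates the `L^q` mean of `T`, then `T ∘ M⁻¹` is bounded in the `L^q` mean. -/
lemma lintegral_enorm_comp_inverse_rpow_le (hq : 0 < q) (hT : AEStronglyMeasurable T volume)
    {R : Cn n →L[ℂ] Cn n} (hMR : ∀ v, M (R v) = v) (hc0 : c ≠ 0) (hc : c ≠ ⊤)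
    (hM : ∀ e, c * (∫⁻ x, ‖T x e‖ₑ ^ q ∂Q.avgMeasure) ^ (1 / q) ≤ ‖M e‖ₑ) :
    ∫⁻ x, ‖T x ∘L R‖ₑ ^ q ∂Q.avgMeasure ≤ (n : ℝ≥0∞) ^ q * (n * (c⁻¹) ^ q) := by
  have hT' := hT.mono_ac Q.avgMeasure_absolutelyContinuous
  have hcol : ∀ j : Fin n,
      ∫⁻ x, ‖T x (R (EuclideanSpace.single j 1))‖ₑ ^ q ∂Q.avgMeasure ≤ (c⁻¹) ^ q := by
    intro j
    have h1 := hM (R (EuclideanSpace.single j 1))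
    rw [hMR, mul_comm, ← ENNReal.le_div_iff_mul_le (Or.inl hc0) (Or.inl hc),
      ← ofReal_norm (EuclideanSpace.single j (1 : ℂ))] at h1
    simp only [PiLp.norm_single, norm_one, ENNReal.ofReal_one, one_div] at h1
    calc _ = ((∫⁻ x, ‖T x (R (EuclideanSpace.single j 1))‖ₑ ^ q ∂Q.avgMeasure) ^ q⁻¹) ^ q := by
          rw [← ENNReal.rpow_mul, inv_mul_cancel₀ hq.ne', ENNReal.rpow_one]
      _ ≤ _ := ENNReal.rpow_le_rpow h1 hq.le
  calc ∫⁻ x, ‖T x ∘L R‖ₑ ^ q ∂Q.avgMeasure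
      ≤ ∫⁻ x, (n : ℝ≥0∞) ^ q * ∑ j, ‖T x (R (EuclideanSpace.single j 1))‖ₑ ^ q ∂Q.avgMeasure :=
        lintegral_mono fun x => enorm_clm_rpow_le (T x ∘L R) hq
    _ = (n : ℝ≥0∞) ^ q *
        ∑ j, ∫⁻ x, ‖T x (R (EuclideanSpace.single j 1))‖ₑ ^ q ∂Q.avgMeasure := by
        rw [lintegral_const_mul' _ _ (ENNReal.rpow_ne_top_of_nonneg hq.le (by simp)),
          lintegral_finsetSum' _ fun j _ =>
            (aestronglyMeasurable_apply hT' _).enorm.pow_const q]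
    _ ≤ (n : ℝ≥0∞) ^ q * ∑ _j : Fin n, (c⁻¹) ^ q := by
        gcongr
        exact hcol _
    _ = _ := by simp

end CubeEstimates

section Converse

variable {d n : ℕ} {Q : Cube d} {p p' q β : ℝ} {T S : Rd d → Cn n →L[ℂ] Cn n}
  {M R : Cn n →L[ℂ] Cn n} {c C : ℝ≥0∞}

lemma enorm_comp_le_enorm_comp_mul (hRM : ∀ v, R (M v) = v) (L L' : Cn n →L[ℂ] Cn n) :
    ‖L ∘L L'‖ₑ ≤ ‖L ∘L R‖ₑ * ‖M ∘L L'‖ₑ := by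
  have h : L ∘L L' = (L ∘L R) ∘L (M ∘L L') := by
    ext1 v
    simp [hRM]
  rw [h]
  exact enorm_comp_le _ _

/-- The off-diagonal mean of `T ∘ S` is bounded when the averaging operator is. -/
lemma apq_le_of_average_le (hpp' : p.HolderConjugate p') (hq : 0 < q)
    (hT : AEStronglyMeasurable T volume) (hS : AEStronglyMeasurable S volume)
    (hMR : ∀ v, M (R v) = v) (hRM : ∀ v, R (M v) = v) (hc0 : c ≠ 0) (hc : c ≠ ⊤)
    (hM : ∀ e, c * (∫⁻ x, ‖T x e‖ₑ ^ q ∂Q.avgMeasure) ^ (1 / q) ≤ ‖M e‖ₑ)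
    (hC : ∀ f : Rd d → Cn n, ENNReal.ofReal Q.vol ^ (1 / q) *
        (ENNReal.ofReal Q.vol ^ β * ∫⁻ y, ‖(M ∘L S y) (f y)‖ₑ ∂Q.avgMeasure) ≤
      C * (∫⁻ y, ‖f y‖ₑ ^ p) ^ (1 / p)) (hCtop : C ≠ ⊤) :
    ENNReal.ofReal Q.vol ^ (β + 1 / q - 1 / p) *
        (∫⁻ x, (∫⁻ y, ‖T x ∘L S y‖ₑ ^ p' ∂Q.avgMeasure) ^ (q / p') ∂Q.avgMeasure) ^ (1 / q) ≤
      ((n : ℝ≥0∞) ^ q * (n * (c⁻¹) ^ q)) ^ (1 / q) * (n * C) := by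
  have hS' := hS.mono_ac Q.avgMeasure_absolutelyContinuous
  have hp' := hpp'.symm.pos
  set N := (n : ℝ≥0∞) * C * ENNReal.ofReal Q.vol ^ (-(β + 1 / q - 1 / p)) with hN
  have hNtop : N ≠ ⊤ := ENNReal.mul_ne_top (ENNReal.mul_ne_top (by simp) hCtop)
    (ENNReal.rpow_ne_top_of_ne_zero Q.ofReal_vol_ne_zero ENNReal.ofReal_ne_top)
  have hMS : (∫⁻ y, ‖M ∘L S y‖ₑ ^ p' ∂Q.avgMeasure) ^ (1 / p') ≤ N :=
    lintegral_rpow_le_of_forall_lintegral_mul_le (k := fun y => ‖M ∘L S y‖₊) (s := 0) hpp'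
      (aestronglyMeasurable_comp_left hS' M).nnnorm.aemeasurable aemeasurable_const
      fun h hh _ => lintegral_enorm_comp_mul_le hpp'.pos hS hC hh
  have hinner : ∀ x, (∫⁻ y, ‖T x ∘L S y‖ₑ ^ p' ∂Q.avgMeasure) ^ (q / p') ≤
      ‖T x ∘L R‖ₑ ^ q * N ^ q := by
    intro x
    have h1 : ∫⁻ y, ‖T x ∘L S y‖ₑ ^ p' ∂Q.avgMeasure ≤
        ‖T x ∘L R‖ₑ ^ p' * ∫⁻ y, ‖M ∘L S y‖ₑ ^ p' ∂Q.avgMeasure := by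
      rw [← lintegral_const_mul' _ _ (ENNReal.rpow_ne_top_of_nonneg hp'.le enorm_ne_top)]
      refine lintegral_mono fun y => ?_
      rw [← ENNReal.mul_rpow_of_nonneg _ _ hp'.le]
      exact ENNReal.rpow_le_rpow (enorm_comp_le_enorm_comp_mul hRM _ _) hp'.le
    calc _ ≤ (‖T x ∘L R‖ₑ ^ p' * ∫⁻ y, ‖M ∘L S y‖ₑ ^ p' ∂Q.avgMeasure) ^ (q / p') :=
          ENNReal.rpow_le_rpow h1 (by positivity)
      _ = ‖T x ∘L R‖ₑ ^ q *
          ((∫⁻ y, ‖M ∘L S y‖ₑ ^ p' ∂Q.avgMeasure) ^ (1 / p')) ^ q := by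
          rw [ENNReal.mul_rpow_of_nonneg _ _ (by positivity), ← ENNReal.rpow_mul,
            ← ENNReal.rpow_mul]
          congr 2 <;> field_simp
      _ ≤ _ := by gcongr
  calc _ ≤ ENNReal.ofReal Q.vol ^ (β + 1 / q - 1 / p) *
        (∫⁻ x, ‖T x ∘L R‖ₑ ^ q * N ^ q ∂Q.avgMeasure) ^ (1 / q) := by
        gcongr with x
        exact hinner x
    _ = (∫⁻ x, ‖T x ∘L R‖ₑ ^ q ∂Q.avgMeasure) ^ (1 / q) *
        (ENNReal.ofReal Q.vol ^ (β + 1 / q - 1 / p) * N) := by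
        rw [lintegral_mul_const' _ _ (ENNReal.rpow_ne_top_of_nonneg hq.le hNtop),
          ENNReal.mul_rpow_of_nonneg _ _ (by positivity), ← ENNReal.rpow_mul,
          mul_one_div_cancel hq.ne', ENNReal.rpow_one]
        ring
    _ ≤ _ := by
        have hv : ENNReal.ofReal Q.vol ^ (β + 1 / q - 1 / p) * N = n * C := by
          rw [hN, mul_left_comm, ← Q.ofReal_vol_rpow_add]
          simp
        rw [hv]
        gcongr
        exact lintegral_enorm_comp_inverse_rpow_le hq hT hMR hc0 hc hM

/-- The endpoint `p = 1` of `apq_le_of_average_le`. -/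
lemma a1q_le_of_average_le (hq : 0 < q)
    (hT : AEStronglyMeasurable T volume) (hS : AEStronglyMeasurable S volume)
    (hMR : ∀ v, M (R v) = v) (hRM : ∀ v, R (M v) = v) (hc0 : c ≠ 0) (hc : c ≠ ⊤)
    (hM : ∀ e, c * (∫⁻ x, ‖T x e‖ₑ ^ q ∂Q.avgMeasure) ^ (1 / q) ≤ ‖M e‖ₑ)
    (hC : ∀ f : Rd d → Cn n, ENNReal.ofReal Q.vol ^ (1 / q) *
        (ENNReal.ofReal Q.vol ^ β * ∫⁻ y, ‖(M ∘L S y) (f y)‖ₑ ∂Q.avgMeasure) ≤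
      C * ∫⁻ y, ‖f y‖ₑ) :
    ∀ᵐ y ∂Q.avgMeasure, ENNReal.ofReal Q.vol ^ (β + 1 / q - 1) *
        (∫⁻ x, ‖T x ∘L S y‖ₑ ^ q ∂Q.avgMeasure) ^ (1 / q) ≤
      ((n : ℝ≥0∞) ^ q * (n * (c⁻¹) ^ q)) ^ (1 / q) * (n * C) := by
  have hS' := hS.mono_ac Q.avgMeasure_absolutelyContinuous
  set N := (n : ℝ≥0∞) * C * ENNReal.ofReal Q.vol ^ (-(β + 1 / q - 1)) with hN
  have hMS : ∀ᵐ y ∂Q.avgMeasure, ‖M ∘L S y‖ₑ ≤ N := by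
    refine ae_le_of_forall_setLIntegral_le_of_sigmaFinite₀
      (aestronglyMeasurable_comp_left hS' M).enorm fun s hs _ => ?_
    have h1 := lintegral_enorm_comp_mul_le (p := 1) (h := s.indicator fun _ => 1) one_pos hS
      (by simpa using hC) ((aemeasurable_const (b := (1 : ℝ≥0))).indicator hs)
    have h2 : ∫⁻ y, ‖M ∘L S y‖ₑ * (s.indicator (fun _ => (1 : ℝ≥0)) y : ℝ≥0) ∂Q.avgMeasure =
        ∫⁻ y in s, ‖M ∘L S y‖ₑ ∂Q.avgMeasure := by
      rw [← lintegral_indicator hs]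
      refine lintegral_congr fun y => ?_
      by_cases hy : y ∈ s <;> simp [hy]
    have h3 : ∫⁻ y, ((s.indicator (fun _ => (1 : ℝ≥0)) y : ℝ≥0) : ℝ≥0∞) ^ (1 : ℝ) ∂Q.avgMeasure =
        Q.avgMeasure s := by
      rw [← lintegral_indicator_one hs]
      refine lintegral_congr fun y => ?_
      by_cases hy : y ∈ s <;> simp [hy]
    rw [h2, h3] at h1
    simpa [hN] using h1
  refine hMS.mono fun y hy => ?_
  calc _ ≤ ENNReal.ofReal Q.vol ^ (β + 1 / q - 1) *
        (∫⁻ x, ‖T x ∘L R‖ₑ ^ q * ‖M ∘L S y‖ₑ ^ q ∂Q.avgMeasure) ^ (1 / q) := by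
        gcongr with x
        rw [← ENNReal.mul_rpow_of_nonneg _ _ hq.le]
        exact ENNReal.rpow_le_rpow (enorm_comp_le_enorm_comp_mul hRM _ _) hq.le
    _ = (∫⁻ x, ‖T x ∘L R‖ₑ ^ q ∂Q.avgMeasure) ^ (1 / q) *
        (ENNReal.ofReal Q.vol ^ (β + 1 / q - 1) * ‖M ∘L S y‖ₑ) := by
        rw [lintegral_mul_const' _ _ (ENNReal.rpow_ne_top_of_nonneg hq.le enorm_ne_top),
          ENNReal.mul_rpow_of_nonneg _ _ (by positivity), ← ENNReal.rpow_mul,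
          mul_one_div_cancel hq.ne', ENNReal.rpow_one]
        ring
    _ ≤ (∫⁻ x, ‖T x ∘L R‖ₑ ^ q ∂Q.avgMeasure) ^ (1 / q) *
        (ENNReal.ofReal Q.vol ^ (β + 1 / q - 1) * N) := by gcongr
    _ ≤ _ := by
        have hv : ENNReal.ofReal Q.vol ^ (β + 1 / q - 1) * N = n * C := by
          rw [hN, mul_left_comm, ← Q.ofReal_vol_rpow_add]
          simp
        rw [hv]
        gcongr
        exact lintegral_enorm_comp_inverse_rpow_le hq hT hMR hc0 hc hM

end Converse

section Operators

variable {d n : ℕ} {α p q : ℝ} {U V : Rd d → Mat n} {𝒰 : Cube d → Mat n}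

/-- The constant value of `B_Q^α f` on `Q`. -/
def cubeAverage (α p : ℝ) (𝒰 : Cube d → Mat n) (V : Rd d → Mat n) (Q : Cube d)
    (f : Rd d → Cn n) : ℝ≥0∞ :=
  ENNReal.ofReal Q.vol ^ (α / (d : ℝ)) *
    ∫⁻ y, ‖(toOp (𝒰 Q) ∘L toOp (matPow (V y) (-(1 / p)))) (f y)‖ₑ ∂Q.avgMeasure

lemma ofReal_vol_rpow (Q : Cube d) (r : ℝ) :
    ENNReal.ofReal (Q.vol ^ r) = ENNReal.ofReal Q.vol ^ r :=
  (ENNReal.ofReal_rpow_of_pos Q.vol_pos).symm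

lemma cubeAverage_eq (Q : Cube d) (f : Rd d → Cn n) :
    ENNReal.ofReal (Q.vol ^ (α / (d : ℝ) - 1)) *
      ∫⁻ y in Q.set, (‖mulVecE (𝒰 Q) (mulVecE (matPow (V y) (-(1 / p))) (f y))‖₊ : ℝ≥0∞) =
    cubeAverage α p 𝒰 V Q f := by
  rw [cubeAverage, Q.lintegral_avgMeasure, ofReal_vol_rpow, sub_eq_add_neg,
    Q.ofReal_vol_rpow_add, ENNReal.rpow_neg_one, mul_assoc]
  rfl

lemma auxMaxOp_eq (f : Rd d → Cn n) (x : Rd d) :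
    auxMaxOp α p 𝒰 V f x = ⨆ (Q : Cube d) (_ : x ∈ Q.set), cubeAverage α p 𝒰 V Q f := by
  simp only [auxMaxOp, cubeAverage_eq]

lemma auxAvgOp_eq (Q : Cube d) (f : Rd d → Cn n) :
    auxAvgOp α p 𝒰 V Q f = Q.set.indicator fun _ => cubeAverage α p 𝒰 V Q f := by
  funext x
  simp only [auxAvgOp, cubeAverage_eq]

lemma auxAvgOp_le_auxMaxOp (Q : Cube d) (f : Rd d → Cn n) (x : Rd d) :
    auxAvgOp α p 𝒰 V Q f x ≤ auxMaxOp α p 𝒰 V f x := by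
  rw [auxAvgOp_eq, auxMaxOp_eq]
  refine Set.indicator_apply_le' (fun hx => ?_) fun _ => zero_le
  exact le_iSup₂ (f := fun (Q : Cube d) (_ : x ∈ Q.set) => cubeAverage α p 𝒰 V Q f) Q hx

lemma WeakLqBound.mono {C : ℝ} {S S' : (Rd d → Cn n) → Rd d → ℝ≥0∞}
    (h : WeakLqBound p q C S) (hq : 0 ≤ q) (hS : ∀ f x, S' f x ≤ S f x) :
    WeakLqBound p q C S' := fun f lam hlam => by
  refine le_trans ?_ (h f lam hlam)
  gcongr with x
  exact hS f x

/-- For `B_Q^α` the weak type bound is a strong bound on its constant value. -/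
lemma cubeAverage_le_of_weakLqBound {C : ℝ} {Q : Cube d}
    (h : WeakLqBound p q C (auxAvgOp α p 𝒰 V Q)) (f : Rd d → Cn n) :
    ENNReal.ofReal Q.vol ^ (1 / q) * cubeAverage α p 𝒰 V Q f ≤
      ENNReal.ofReal C * (∫⁻ y, ‖f y‖ₑ ^ p) ^ (1 / p) := by
  have hv0 : ENNReal.ofReal Q.vol ^ (1 / q) ≠ 0 := by
    simp [ENNReal.rpow_eq_zero_iff, Q.vol_pos]
  have hvt : ENNReal.ofReal Q.vol ^ (1 / q) ≠ ⊤ :=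
    ENNReal.rpow_ne_top_of_ne_zero Q.ofReal_vol_ne_zero ENNReal.ofReal_ne_top
  rw [mul_comm, ← ENNReal.le_div_iff_mul_le (Or.inl hv0) (Or.inl hvt)]
  refine ENNReal.le_of_forall_nnreal_lt fun r hr => ?_
  rcases eq_or_ne r 0 with rfl | hr0
  · simp
  rw [ENNReal.le_div_iff_mul_le (Or.inl hv0) (Or.inl hvt)]
  have h1 := h f r (by positivity)
  have h2 : {x | ENNReal.ofReal (r : ℝ) < auxAvgOp α p 𝒰 V Q f x} = Q.set := by
    ext x
    rw [auxAvgOp_eq]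
    by_cases hx : x ∈ Q.set <;> simp [hx, hr]
  rwa [h2, Q.volume_set, ENNReal.ofReal_coe_nnreal] at h1

lemma matrixApq_eq {p' : ℝ} (hpp' : p.HolderConjugate p') :
    matrixApq α p q U V = ⨆ Q : Cube d, ENNReal.ofReal Q.vol ^ (α / (d : ℝ) + 1 / q - 1 / p) *
      (∫⁻ x, (∫⁻ y, ‖toOp (matPow (U x) (1 / q)) ∘L toOp (matPow (V y) (-(1 / p)))‖ₑ ^ p'
        ∂Q.avgMeasure) ^ (q / p') ∂Q.avgMeasure) ^ (1 / q) := by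
  have h1 : p / (p - 1) = p' := hpp'.conjugate_eq.symm
  have h2 : q * (p - 1) / p = q / p' := by rw [← h1, div_div_eq_mul_div]
  simp only [matrixApq, h1, h2, ofReal_vol_rpow, ofReal_opNorm_mul, Cube.lintegral_avgMeasure]

lemma matrixA1q_eq (hV : IsMatrixWeight V) :
    matrixA1q α q U V = ⨆ Q : Cube d, ENNReal.ofReal Q.vol ^ (α / (d : ℝ) + 1 / q - 1) *
      essSup (fun y => (∫⁻ x, ‖toOp (matPow (U x) (1 / q)) ∘L toOp (matPow (V y) (-(1 / 1)))‖ₑ ^ q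
        ∂Q.avgMeasure) ^ (1 / q)) (volume.restrict Q.set) := by
  simp only [matrixA1q, ofReal_vol_rpow, ofReal_opNorm_mul, ← Cube.lintegral_avgMeasure]
  refine iSup_congr fun Q => ?_
  refine congr_arg _ (essSup_congr_ae ((ae_restrict_of_ae hV.2).mono fun y hy => ?_))
  simp only [div_one, matPow_neg_one hy]

section Reduces

variable {c₁ c₂ : ℝ} {Q : Cube d} {A : Mat n}

lemma ReducesLq.enorm_le (h : ReducesLq q c₁ c₂ U Q A) (e : Cn n) :
    ‖toOp A e‖ₑ ≤ ENNReal.ofReal c₂ *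
      (∫⁻ x, ‖toOp (matPow (U x) (1 / q)) e‖ₑ ^ q ∂Q.avgMeasure) ^ (1 / q) := by
  rw [Q.lintegral_avgMeasure]
  exact (h.2 e).2

lemma ReducesLq.le_enorm (h : ReducesLq q c₁ c₂ U Q A) (e : Cn n) :
    ENNReal.ofReal c₁ *
      (∫⁻ x, ‖toOp (matPow (U x) (1 / q)) e‖ₑ ^ q ∂Q.avgMeasure) ^ (1 / q) ≤ ‖toOp A e‖ₑ := by
  rw [Q.lintegral_avgMeasure]
  exact (h.2 e).1

end Reduces

lemma toOp_apply_toOp_of_mul_eq_one {A B : Mat n} (h : A * B = 1) (v : Cn n) :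
    toOp A (toOp B v) = v := by
  have h1 := congr_arg (fun L : Cn n →L[ℂ] Cn n => L v)
    (map_mul (Matrix.toEuclideanCLM (n := Fin n) (𝕜 := ℂ)) A B)
  rw [h, map_one] at h1
  exact h1.symm

/-- The bound on cube averages provided by the `A_{p,q}^α` condition. -/
lemma cubeAverage_le_of_matrixApqFull_lt_top {c₁ c₂ : ℝ} (hp : 1 ≤ p) (hq : 0 < q)
    (hV : IsMatrixWeight V) (h𝒰 : ∀ Q : Cube d, ReducesLq q c₁ c₂ U Q (𝒰 Q))
    (h : matrixApqFull α p q U V < ⊤) (Q : Cube d) (f : Rd d → Cn n) :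
    ENNReal.ofReal Q.vol ^ (1 / q) * cubeAverage α p 𝒰 V Q f ≤
      (n : ℝ≥0∞) ^ 2 * ENNReal.ofReal c₂ * matrixApqFull α p q U V *
        (∫⁻ y in Q.set, ‖f y‖ₑ ^ p) ^ (1 / p) := by
  rcases hp.eq_or_lt with rfl | hp1
  · simp only [matrixApqFull, if_true] at h ⊢
    have hle : ∀ᵐ y ∂Q.avgMeasure, ENNReal.ofReal Q.vol ^ (α / (d : ℝ) + 1 / q - 1) *
        (∫⁻ x, ‖toOp (matPow (U x) (1 / q)) ∘L toOp (matPow (V y) (-(1 / 1)))‖ₑ ^ q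
          ∂Q.avgMeasure) ^ (1 / q) ≤ matrixA1q α q U V := by
      rw [Q.ae_avgMeasure_iff, matrixA1q_eq hV]
      have hess := ENNReal.ae_le_essSup (μ := volume.restrict Q.set) fun y =>
        (∫⁻ x, ‖toOp (matPow (U x) (1 / q)) ∘L toOp (matPow (V y) (-(1 / 1)))‖ₑ ^ q
          ∂Q.avgMeasure) ^ (1 / q)
      exact hess.mono fun y hy => le_iSup_of_le Q (mul_le_mul' le_rfl hy)
    simpa [cubeAverage] using
      average_le_of_eq_one hq (h𝒰 Q).enorm_le h.ne ENNReal.ofReal_ne_top hle f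
  · have hpp' := Real.HolderConjugate.conjExponent hp1
    simp only [matrixApqFull, if_neg hp1.ne'] at h ⊢
    refine (average_le_of_one_lt hpp' hq (hV.aestronglyMeasurable_matPow _)
      (h𝒰 Q).enorm_le f).trans ?_
    rw [matrixApq_eq hpp']
    gcongr
    exact le_iSup_of_le Q le_rfl

lemma exists_weakLqBound_auxMaxOp {c₁ c₂ : ℝ} (hd : d ≠ 0) (hp : 1 ≤ p) (hpq : p ≤ q)
    (hV : IsMatrixWeight V) (h𝒰 : ∀ Q : Cube d, ReducesLq q c₁ c₂ U Q (𝒰 Q))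
    (h : matrixApqFull α p q U V < ⊤) :
    ∃ C : ℝ, 0 < C ∧ WeakLqBound p q C (auxMaxOp α p 𝒰 V) := by
  have hq : 0 < q := by linarith
  set K : ℝ≥0∞ := (n : ℝ≥0∞) ^ 2 * ENNReal.ofReal c₂ * matrixApqFull α p q U V + 1 with hK
  have hKtop : K ≠ ⊤ := by finiteness
  have hK0 : K ≠ 0 := by simp [hK]
  have h5 : ((5 : ℝ≥0∞) ^ d) ^ (1 / q) * K ≠ ⊤ :=
    ENNReal.mul_ne_top (ENNReal.rpow_ne_top_of_nonneg (by positivity) (by finiteness)) hKtop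
  refine ⟨(((5 : ℝ≥0∞) ^ d) ^ (1 / q) * K).toReal, ENNReal.toReal_pos ?_ h5,
    fun f lam hlam => ?_⟩
  · exact mul_ne_zero (by simp [ENNReal.rpow_eq_zero_iff]) hK0
  rw [ENNReal.ofReal_toReal h5]
  simp only [auxMaxOp_eq]
  refine weak_type_of_forall_cube hd (by linarith) hpq hK0 hKtop (fun Q => ?_) hlam
  refine (cubeAverage_le_of_matrixApqFull_lt_top hp hq hV h𝒰 h Q f).trans ?_
  exact mul_le_mul' le_self_add le_rfl

lemma matrixApqFull_lt_top_of_weakLqBound {c₁ c₂ C : ℝ} (hp : 1 ≤ p) (hq : 0 < q)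
    (hU : IsMatrixWeight U) (hV : IsMatrixWeight V) (hc₁ : 0 < c₁)
    (h𝒰 : ∀ Q : Cube d, ReducesLq q c₁ c₂ U Q (𝒰 Q))
    (h : ∀ Q : Cube d, WeakLqBound p q C (auxAvgOp α p 𝒰 V Q)) :
    matrixApqFull α p q U V < ⊤ := by
  have hc0 : ENNReal.ofReal c₁ ≠ 0 := by simpa using hc₁
  have hunit : ∀ Q, IsUnit (𝒰 Q).det := fun Q => (h𝒰 Q).1.det_pos.ne'.isUnit
  have hMR : ∀ Q v, toOp (𝒰 Q) (toOp (𝒰 Q)⁻¹ v) = v := fun Q =>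
    toOp_apply_toOp_of_mul_eq_one (Matrix.mul_nonsing_inv _ (hunit Q))
  have hRM : ∀ Q v, toOp (𝒰 Q)⁻¹ (toOp (𝒰 Q) v) = v := fun Q =>
    toOp_apply_toOp_of_mul_eq_one (Matrix.nonsing_inv_mul _ (hunit Q))
  set B : ℝ≥0∞ := ((n : ℝ≥0∞) ^ q * (n * ((ENNReal.ofReal c₁)⁻¹) ^ q)) ^ (1 / q) *
    (n * ENNReal.ofReal C)
  have hB : B < ⊤ := by
    have h1 : (ENNReal.ofReal c₁)⁻¹ ≠ ⊤ := ENNReal.inv_ne_top.2 hc0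
    have h2 : (0 : ℝ) ≤ 1 / q := by positivity
    finiteness
  refine lt_of_le_of_lt ?_ hB
  have hT := hU.aestronglyMeasurable_matPow (1 / q)
  have hS := hV.aestronglyMeasurable_matPow (-(1 / p))
  have hC := fun Q : Cube d => cubeAverage_le_of_weakLqBound (h Q)
  rcases hp.eq_or_lt with rfl | hp1
  · simp only [matrixApqFull, if_true]
    rw [matrixA1q_eq hV]
    refine iSup_le fun Q => ?_
    have hle := a1q_le_of_average_le hq hT hS (hMR Q) (hRM Q) hc0 ENNReal.ofReal_ne_top
      (h𝒰 Q).le_enorm (fun f => by simpa [cubeAverage] using hC Q f)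
    rw [Q.ae_avgMeasure_iff] at hle
    rw [← ENNReal.essSup_const_mul]
    exact essSup_le_of_ae_le _ hle
  · have hpp' := Real.HolderConjugate.conjExponent hp1
    simp only [matrixApqFull, if_neg hp1.ne']
    rw [matrixApq_eq hpp']
    exact iSup_le fun Q => apq_le_of_average_le hpp' hq hT hS (hMR Q) (hRM Q) hc0
      ENNReal.ofReal_ne_top (h𝒰 Q).le_enorm (hC Q) ENNReal.ofReal_ne_top

end Operators

/-- **Theorem 1.20.** `(U,V) ∈ A_{p,q}^α` iff the auxiliary maximal operator `M'_{α,U,V}` maps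
`L^p` to `L^{q,∞}`, iff the operators `B_Q^α` map `L^p` to `L^{q,∞}` uniformly in `Q`. -/
theorem weak_type_characterization {d n : ℕ} (α p q : ℝ)
    (hα0 : 0 ≤ α) (hαd : α < d) (hp : 1 ≤ p) (hpq : p ≤ q)
    (hexp : 1 / p - 1 / q ≤ α / (d : ℝ))
    (U V : Rd d → Mat n) (hU : IsMatrixWeight U) (hV : IsMatrixWeight V)
    (c₁ c₂ : ℝ) (hc₁ : 0 < c₁) (hc₂ : 0 < c₂)
    (𝒰 : Cube d → Mat n) (h𝒰 : ∀ Q : Cube d, ReducesLq q c₁ c₂ U Q (𝒰 Q)) :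
    (matrixApqFull α p q U V < ⊤ ↔
        ∃ C : ℝ, 0 < C ∧ WeakLqBound p q C (auxMaxOp α p 𝒰 V)) ∧
    (matrixApqFull α p q U V < ⊤ ↔
        ∃ C : ℝ, 0 < C ∧ ∀ Q : Cube d, WeakLqBound p q C (auxAvgOp α p 𝒰 V Q)) := by
  have hd : d ≠ 0 := by
    rintro rfl
    exact absurd hαd (by simpa using hα0)
  have hq : 0 < q := by linarith
  have h12 := exists_weakLqBound_auxMaxOp (α := α) hd hp hpq hV h𝒰
  have h23 : ∀ C, WeakLqBound p q C (auxMaxOp α p 𝒰 V) →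
      ∀ Q : Cube d, WeakLqBound p q C (auxAvgOp α p 𝒰 V Q) := fun C h Q =>
    h.mono hq.le fun f x => auxAvgOp_le_auxMaxOp Q f x
  have h31 : ∀ C, (∀ Q : Cube d, WeakLqBound p q C (auxAvgOp α p 𝒰 V Q)) →
      matrixApqFull α p q U V < ⊤ := fun C =>
    matrixApqFull_lt_top_of_weakLqBound hp hq hU hV hc₁ h𝒰
  refine ⟨⟨h12, ?_⟩, ⟨fun h => ?_, ?_⟩⟩
  · rintro ⟨C, -, hC⟩
    exact h31 C (h23 C hC)
  · obtain ⟨C, hC0, hC⟩ := h12 h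
    exact ⟨C, hC0, h23 C hC⟩
  · rintro ⟨C, -, hC⟩
    exact h31 C hC

end
end

section
/- Let A and B be n×n matrix weights on ℝ^d, let Φ and Ψ be Young functions, let Q be a cube, and let 𝒜_Q^Ψ and ℬ_Q^Φ be reducing operators of A and B respectively. Then, with implicit constants depending only on the dimension: (i) |𝒜_Q^Ψ|_op ≈ ‖A‖_{Ψ,Q}; and (ii) |𝒜_Q^Ψ ℬ_Q^Φ|_op ≈ ‖A(x) ℬ_Q^Φ‖_{Ψ_x,Q} ≈ ‖ ‖A(x)B(y)‖_{Φ_y,Q} ‖_{Ψ_x,Q} (inner norm in y, outer in x). -/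
open MeasureTheory ENNReal
open scoped NNReal ComplexOrder

noncomputable section

/-- Two extended nonnegative quantities are comparable with constant `C`. -/
def Comparable (C : ℝ) (a b : ℝ≥0∞) : Prop :=
  a ≤ ENNReal.ofReal C * b ∧ b ≤ ENNReal.ofReal C * a

/-- `M` is a reducing operator of the matrix function `A` with respect to the Young function `Φ`
on the cube `Q`, with comparability constants `c₁, c₂`:  `|M e| ≈ ‖A e‖_{Φ,Q}` for all `e`. -/
def ReducesOrlicz {d n : ℕ} (c₁ c₂ : ℝ) (Φ : ℝ → ℝ) (A : Rd d → Mat n) (Q : Cube d)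
    (M : Mat n) : Prop :=
  M.PosDef ∧ ∀ e : Cn n,
    ENNReal.ofReal c₁ * luxNorm Φ Q (fun x => ‖mulVecE (A x) e‖) ≤ (‖mulVecE M e‖₊ : ℝ≥0∞) ∧
    (‖mulVecE M e‖₊ : ℝ≥0∞) ≤ ENNReal.ofReal c₂ * luxNorm Φ Q (fun x => ‖mulVecE (A x) e‖)

section Lux

variable {d : ℕ} {Φ : ℝ → ℝ} {Q : Cube d}

lemma luxNormE_le_mul (hΦ : IsYoungFunction Φ) {f g : Rd d → ℝ≥0∞} {C : ℝ≥0∞} (hC0 : C ≠ 0)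
    (hC : C ≠ ⊤) (h : ∀ᵐ x, f x ≤ C * g x) (hg : ∀ᵐ x, g x ≠ ⊤) :
    luxNormE Φ Q f ≤ C * luxNormE Φ Q g := by
  rw [mul_comm, ← ENNReal.div_le_iff_le_mul (Or.inl hC0) (Or.inl hC)]
  refine le_sInf fun lam ⟨h0, ht, hl⟩ => ?_
  rw [ENNReal.div_le_iff_le_mul (Or.inl hC0) (Or.inl hC), mul_comm]
  refine sInf_le ⟨ENNReal.mul_pos hC0 h0.ne', ENNReal.mul_lt_top hC.lt_top ht, ?_⟩
  refine (lintegral_mono_ae ?_).trans hl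
  refine ae_restrict_of_ae ?_
  filter_upwards [h, hg] with x hx hgx
  have hl0 : 0 < lam.toReal := ENNReal.toReal_pos h0.ne' ht.ne
  have hC1 : 0 < C.toReal := ENNReal.toReal_pos hC0 hC
  refine ENNReal.ofReal_le_ofReal (hΦ.monotoneOn ?_ ?_ ?_)
  · exact div_nonneg ENNReal.toReal_nonneg ENNReal.toReal_nonneg
  · exact div_nonneg ENNReal.toReal_nonneg ENNReal.toReal_nonneg
  · have := ENNReal.toReal_mono (ENNReal.mul_ne_top hC hgx) hx
    rw [ENNReal.toReal_mul] at this
    rw [ENNReal.toReal_mul, div_le_div_iff₀ (by positivity) hl0]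
    nlinarith

lemma luxNorm_mono (hΦ : IsYoungFunction Φ) {f g : Rd d → ℝ} (h : ∀ᵐ x, |f x| ≤ |g x|) :
    luxNorm Φ Q f ≤ luxNorm Φ Q g := by
  have := luxNormE_le_mul (Q := Q) hΦ (f := fun x => ENNReal.ofReal |f x|)
    (g := fun x => ENNReal.ofReal |g x|) one_ne_zero one_ne_top
    (by filter_upwards [h] with x hx; simpa using ENNReal.ofReal_le_ofReal hx)
    (by simp)
  simpa [luxNorm] using this

lemma luxNorm_congr {f g : Rd d → ℝ} (h : ∀ᵐ x, f x = g x) :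
    luxNorm Φ Q f = luxNorm Φ Q g := by
  have key : ∀ lam : ℝ≥0∞,
      (∫⁻ x in Q.set, ENNReal.ofReal (Φ ((ENNReal.ofReal |f x|).toReal / lam.toReal))) =
      ∫⁻ x in Q.set, ENNReal.ofReal (Φ ((ENNReal.ofReal |g x|).toReal / lam.toReal)) := by
    intro lam
    refine lintegral_congr_ae (ae_restrict_of_ae ?_)
    filter_upwards [h] with x hx
    rw [hx]
  simp only [luxNorm, luxNormE, key]

lemma IsYoungFunction.nonneg (hΦ : IsYoungFunction Φ) {t : ℝ} (ht : 0 ≤ t) : 0 ≤ Φ t :=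
  hΦ.map_zero ▸ hΦ.monotoneOn Set.self_mem_Ici ht ht

lemma IsYoungFunction.measurable_max (hΦ : IsYoungFunction Φ) :
    Measurable fun t => Φ (max t 0) := by
  refine Monotone.measurable fun s t h => hΦ.monotoneOn ?_ ?_ (max_le_max h le_rfl) <;> simp

lemma luxNorm_add_le (hΦ : IsYoungFunction Φ) {f g : Rd d → ℝ} (hf : AEMeasurable f)
    (hf0 : ∀ x, 0 ≤ f x) (hg0 : ∀ x, 0 ≤ g x) :
    luxNorm Φ Q (fun x => f x + g x) ≤ luxNorm Φ Q f + luxNorm Φ Q g := by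
  rw [← tsub_le_iff_left]
  refine le_sInf fun b ⟨hb0, hbt, hb⟩ => ?_
  rw [tsub_le_iff_right, ← tsub_le_iff_left]
  refine le_sInf fun a ⟨ha0, hat, ha⟩ => ?_
  rw [tsub_le_iff_left]
  have ha1 : 0 < a.toReal := ENNReal.toReal_pos ha0.ne' hat.ne
  have hb1 : 0 < b.toReal := ENNReal.toReal_pos hb0.ne' hbt.ne
  have hab : (b + a).toReal = b.toReal + a.toReal := ENNReal.toReal_add hbt.ne hat.ne
  refine sInf_le ⟨hb0.trans_le le_self_add, ENNReal.add_lt_top.2 ⟨hbt, hat⟩, ?_⟩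
  simp only [abs_of_nonneg (hf0 _), abs_of_nonneg (hg0 _),
    abs_of_nonneg (add_nonneg (hf0 _) (hg0 _)), ENNReal.toReal_ofReal (hf0 _),
    ENNReal.toReal_ofReal (hg0 _), ENNReal.toReal_ofReal (add_nonneg (hf0 _) (hg0 _)),
    hab] at ha hb ⊢
  set α := a.toReal
  set β := b.toReal
  have hs : 0 < β + α := by positivity
  have hmeas : AEMeasurable (fun x => ENNReal.ofReal (Φ (f x / α))) (volume.restrict Q.set) := by
    have h1 : AEMeasurable (fun x => Φ (max (f x / α) 0)) (volume.restrict Q.set) :=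
      hΦ.measurable_max.comp_aemeasurable (hf.restrict.div_const α)
    have h2 : (fun x => Φ (max (f x / α) 0)) = fun x => Φ (f x / α) := by
      funext x
      rw [max_eq_left (div_nonneg (hf0 x) ha1.le)]
    rw [h2] at h1
    exact h1.ennreal_ofReal
  calc (∫⁻ x in Q.set, ENNReal.ofReal (Φ ((f x + g x) / (β + α))))
      ≤ ∫⁻ x in Q.set, (ENNReal.ofReal (α / (β + α)) * ENNReal.ofReal (Φ (f x / α)) +
          ENNReal.ofReal (β / (β + α)) * ENNReal.ofReal (Φ (g x / β))) := by
        refine lintegral_mono fun x => ?_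
        have hfx : 0 ≤ f x / α := div_nonneg (hf0 x) ha1.le
        have hgx : 0 ≤ g x / β := div_nonneg (hg0 x) hb1.le
        have hα : 0 ≤ α / (β + α) := by positivity
        have hβ : 0 ≤ β / (β + α) := by positivity
        have hc := hΦ.convexOn.2 (Set.mem_Ici.2 hfx) (Set.mem_Ici.2 hgx) hα hβ
          (by field_simp; ring)
        simp only [smul_eq_mul] at hc
        have he : α / (β + α) * (f x / α) + β / (β + α) * (g x / β) =
            (f x + g x) / (β + α) := by field_simp
        rw [he] at hc
        dsimp only
        rw [← ENNReal.ofReal_mul hα, ← ENNReal.ofReal_mul hβ, ← ENNReal.ofReal_add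
          (mul_nonneg hα (hΦ.nonneg hfx)) (mul_nonneg hβ (hΦ.nonneg hgx))]
        exact ENNReal.ofReal_le_ofReal hc
    _ = ENNReal.ofReal (α / (β + α)) * (∫⁻ x in Q.set, ENNReal.ofReal (Φ (f x / α))) +
          ENNReal.ofReal (β / (β + α)) * ∫⁻ x in Q.set, ENNReal.ofReal (Φ (g x / β)) := by
        rw [lintegral_add_left' (hmeas.const_mul _), lintegral_const_mul' _ _ ofReal_ne_top,
          lintegral_const_mul' _ _ ofReal_ne_top]
    _ ≤ ENNReal.ofReal (α / (β + α)) * ENNReal.ofReal Q.vol +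
          ENNReal.ofReal (β / (β + α)) * ENNReal.ofReal Q.vol := by gcongr
    _ = ENNReal.ofReal Q.vol := by
        rw [← add_mul, ← ENNReal.ofReal_add (by positivity) (by positivity)]
        have : α / (β + α) + β / (β + α) = 1 := by field_simp; ring
        rw [this, ENNReal.ofReal_one, one_mul]

lemma luxNorm_zero (hΦ : IsYoungFunction Φ) : luxNorm Φ Q (fun _ => 0) = 0 := by
  refine le_antisymm (ENNReal.le_of_forall_pos_le_add fun ε hε _ => ?_) zero_le
  refine sInf_le ⟨by simpa using hε, by simp, ?_⟩
  simp [hΦ.map_zero]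

lemma luxNorm_sum_le (hΦ : IsYoungFunction Φ) {ι : Type*} (s : Finset ι) {f : ι → Rd d → ℝ}
    (hf : ∀ i, AEMeasurable (f i)) (hf0 : ∀ i x, 0 ≤ f i x) :
    luxNorm Φ Q (fun x => ∑ i ∈ s, f i x) ≤ ∑ i ∈ s, luxNorm Φ Q (f i) := by
  classical
  induction s using Finset.induction_on with
  | empty => simp [luxNorm_zero hΦ]
  | insert i s his ih =>
    simp only [Finset.sum_insert his]
    refine (luxNorm_add_le hΦ (hf i) (hf0 i) fun x => Finset.sum_nonneg fun j _ => hf0 j x).trans ?_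
    gcongr

end Lux

section OpNorm

variable {n : ℕ}

lemma mulVecE_eq_toEuclideanCLM (M : Mat n) (v : Cn n) :
    mulVecE M v = Matrix.toEuclideanCLM (𝕜 := ℂ) M v := rfl

lemma mulVecE_mul (M N : Mat n) (v : Cn n) : mulVecE (M * N) v = mulVecE M (mulVecE N v) := by
  simp [mulVecE_eq_toEuclideanCLM]

lemma opNorm_nonneg (M : Mat n) : 0 ≤ opNorm M := norm_nonneg _

lemma norm_mulVecE_single_le (M : Mat n) (j : Fin n) :
    ‖mulVecE M (EuclideanSpace.single j 1)‖ ≤ opNorm M := by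
  simpa [opNorm, mulVecE_eq_toEuclideanCLM] using
    (Matrix.toEuclideanCLM (𝕜 := ℂ) M).le_opNorm (EuclideanSpace.single j 1)

lemma opNorm_le_sum (M : Mat n) :
    opNorm M ≤ ∑ j, ‖mulVecE M (EuclideanSpace.single j 1)‖ := by
  refine ContinuousLinearMap.opNorm_le_bound _ (by positivity) fun v => ?_
  have hv : v = ∑ j, v j • EuclideanSpace.single j (1 : ℂ) := by
    simpa using ((EuclideanSpace.basisFun (Fin n) ℂ).sum_repr v).symm
  conv_lhs => rw [hv]
  rw [map_sum, Finset.sum_mul]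
  refine (norm_sum_le _ _).trans (Finset.sum_le_sum fun j _ => ?_)
  rw [map_smul, norm_smul, mul_comm, mulVecE_eq_toEuclideanCLM]
  gcongr
  exact PiLp.norm_apply_le v j

lemma opNorm_conjTranspose (M : Mat n) : opNorm M.conjTranspose = opNorm M :=
  Matrix.l2_opNorm_conjTranspose M

lemma opNorm_mul_comm {M N : Mat n} (hM : M.IsHermitian) (hN : N.IsHermitian) :
    opNorm (M * N) = opNorm (N * M) := by
  rw [← opNorm_conjTranspose, Matrix.conjTranspose_mul, hM.eq, hN.eq]

end OpNorm

lemma IsMatrixWeight.aemeasurable_norm_mulVecE {d n : ℕ} {A : Rd d → Mat n}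
    (hA : IsMatrixWeight A) (v : Cn n) : AEMeasurable fun x => ‖mulVecE (A x) v‖ := by
  have h : ∀ i, AEMeasurable fun x => (mulVecE (A x) v) i := fun i => by
    have : (fun x => (mulVecE (A x) v) i) = fun x => ∑ j, A x i j * v j := by
      funext x
      simp [mulVecE, Matrix.mulVec, dotProduct]
    rw [this]
    exact Finset.aemeasurable_fun_sum _ fun j _ =>
      (hA.1 i j).aestronglyMeasurable.aemeasurable.mul_const _
  simp only [EuclideanSpace.norm_eq]
  exact (Finset.aemeasurable_fun_sum _ fun i _ => ((h i).norm.pow_const 2)).sqrt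

/-- A reducing operator, multiplied by any constant matrix on the right, still computes the
Luxemburg norm of the matrix weight up to a constant. -/
lemma ReducesOrlicz.comparable_opNorm_mul {d n : ℕ} {c₁ c₂ : ℝ} (hc₁ : 0 < c₁) (hc₂ : 0 < c₂)
    {Φ : ℝ → ℝ} (hΦ : IsYoungFunction Φ) {A : Rd d → Mat n} (hA : IsMatrixWeight A)
    {Q : Cube d} {M : Mat n} (hM : ReducesOrlicz c₁ c₂ Φ A Q M) (N : Mat n) :
    Comparable ((n + 1) * (c₂ + c₁⁻¹)) (ENNReal.ofReal (opNorm (M * N)))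
      (luxNorm Φ Q fun x => opNorm (A x * N)) := by
  set e : Fin n → Cn n := fun j => mulVecE N (EuclideanSpace.single j 1)
  have hinv : (0 : ℝ) < c₁⁻¹ := inv_pos.2 hc₁
  have hM2 := hM.2
  simp only [← enorm_eq_nnnorm, ← ofReal_norm] at hM2
  have hconst : ∀ c : ℝ, 0 ≤ c → c ≤ c₂ + c₁⁻¹ →
      ∀ b : ℝ≥0∞, ∑ _j : Fin n, ENNReal.ofReal c * b ≤
        ENNReal.ofReal ((n + 1) * (c₂ + c₁⁻¹)) * b := by
    intro c hc0 hc b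
    rw [Finset.sum_const, Finset.card_univ, Fintype.card_fin, nsmul_eq_mul, ← mul_assoc,
      ← ENNReal.ofReal_natCast, ← ENNReal.ofReal_mul (by positivity)]
    gcongr
    linarith
  constructor
  · calc ENNReal.ofReal (opNorm (M * N))
        ≤ ENNReal.ofReal (∑ j, ‖mulVecE M (e j)‖) := by
          refine ENNReal.ofReal_le_ofReal ((opNorm_le_sum _).trans_eq ?_)
          simp only [mulVecE_mul, e]
      _ = ∑ j, ENNReal.ofReal ‖mulVecE M (e j)‖ :=
          ENNReal.ofReal_sum_of_nonneg fun _ _ => norm_nonneg _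
      _ ≤ ∑ _j : Fin n, ENNReal.ofReal c₂ * luxNorm Φ Q fun x => opNorm (A x * N) := by
          refine Finset.sum_le_sum fun j _ => (hM2 (e j)).2.trans ?_
          gcongr
          refine luxNorm_mono hΦ (.of_forall fun x => ?_)
          rw [abs_of_nonneg (norm_nonneg _), abs_of_nonneg (opNorm_nonneg _), ← mulVecE_mul]
          exact norm_mulVecE_single_le _ j
      _ ≤ _ := hconst c₂ hc₂.le (by linarith) _
  · calc luxNorm Φ Q (fun x => opNorm (A x * N))
        ≤ luxNorm Φ Q (fun x => ∑ j, ‖mulVecE (A x) (e j)‖) := by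
          refine luxNorm_mono hΦ (.of_forall fun x => ?_)
          rw [abs_of_nonneg (opNorm_nonneg _), abs_of_nonneg (by positivity)]
          simpa only [mulVecE_mul] using opNorm_le_sum (A x * N)
      _ ≤ ∑ j, luxNorm Φ Q (fun x => ‖mulVecE (A x) (e j)‖) :=
          luxNorm_sum_le hΦ _ (fun j => hA.aemeasurable_norm_mulVecE (e j))
            fun _ _ => norm_nonneg _
      _ ≤ ∑ _j : Fin n, ENNReal.ofReal c₁⁻¹ * ENNReal.ofReal (opNorm (M * N)) := by
          refine Finset.sum_le_sum fun j _ => ?_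
          rw [ENNReal.ofReal_inv_of_pos hc₁, mul_comm, ← div_eq_mul_inv,
            ENNReal.le_div_iff_mul_le (by simp [hc₁]) (by simp), mul_comm]
          refine (hM2 (e j)).1.trans (ENNReal.ofReal_le_ofReal ?_)
          rw [← mulVecE_mul]
          exact norm_mulVecE_single_le _ j
      _ ≤ _ := hconst c₁⁻¹ hinv.le (by linarith) _

/-- **Proposition 2.2.**  Norm estimates for reducing operators:
`|𝒜_Q^Ψ|_op ≈ ‖A‖_{Ψ,Q}` and
`|𝒜_Q^Ψ ℬ_Q^Φ|_op ≈ ‖A(x)ℬ_Q^Φ‖_{Ψ_x,Q} ≈ ‖‖A(x)B(y)‖_{Φ_y,Q}‖_{Ψ_x,Q}`,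
with implicit constants depending only on the dimensions (and the comparability constants of
the reducing operators). -/
theorem reducing_operator_norms (d n : ℕ) (c₁ c₂ : ℝ) (hc₁ : 0 < c₁) (hc₂ : 0 < c₂) :
    ∃ C : ℝ, 0 < C ∧
      ∀ (A B : Rd d → Mat n), IsMatrixWeight A → IsMatrixWeight B →
      ∀ (Φ Ψ : ℝ → ℝ), IsYoungFunction Φ → IsYoungFunction Ψ →
      ∀ (Q : Cube d) (𝒜 ℬ : Mat n),
        ReducesOrlicz c₁ c₂ Ψ A Q 𝒜 → ReducesOrlicz c₁ c₂ Φ B Q ℬ →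
        Comparable C (ENNReal.ofReal (opNorm 𝒜)) (luxNorm Ψ Q fun x => opNorm (A x)) ∧
        Comparable C (ENNReal.ofReal (opNorm (𝒜 * ℬ)))
          (luxNorm Ψ Q fun x => opNorm (A x * ℬ)) ∧
        Comparable C (luxNorm Ψ Q fun x => opNorm (A x * ℬ))
          (luxNormE Ψ Q fun x => luxNorm Φ Q fun y => opNorm (A x * B y)) := by
  have hC : (0 : ℝ) < (n + 1) * (c₂ + c₁⁻¹) := by positivity
  refine ⟨(n + 1) * (c₂ + c₁⁻¹), hC, ?_⟩
  intro A B hA hB Φ Ψ hΦ hΨ Q 𝒜 ℬ h𝒜 hℬ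
  refine ⟨by simpa using h𝒜.comparable_opNorm_mul hc₁ hc₂ hΨ hA 1,
    h𝒜.comparable_opNorm_mul hc₁ hc₂ hΨ hA ℬ, ?_⟩
  have key : ∀ᵐ x, Comparable ((n + 1) * (c₂ + c₁⁻¹)) (ENNReal.ofReal |opNorm (A x * ℬ)|)
      (luxNorm Φ Q fun y => opNorm (A x * B y)) := by
    filter_upwards [hA.2] with x hx
    have h1 : (luxNorm Φ Q fun y => opNorm (A x * B y)) =
        luxNorm Φ Q fun y => opNorm (B y * A x) := by
      refine luxNorm_congr ?_
      filter_upwards [hB.2] with y hy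
      exact opNorm_mul_comm hx.isHermitian hy.isHermitian
    rw [h1, abs_of_nonneg (opNorm_nonneg _), opNorm_mul_comm hx.isHermitian hℬ.1.isHermitian]
    exact hℬ.comparable_opNorm_mul hc₁ hc₂ hΦ hB (A x)
  have hC0 : ENNReal.ofReal ((n + 1) * (c₂ + c₁⁻¹)) ≠ 0 := by simpa using hC
  constructor
  · refine luxNormE_le_mul hΨ hC0 ofReal_ne_top (key.mono fun x hx => hx.1) ?_
    exact key.mono fun x hx => ne_top_of_le_ne_top (mul_ne_top ofReal_ne_top ofReal_ne_top) hx.2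
  · exact luxNormE_le_mul hΨ hC0 ofReal_ne_top (key.mono fun x hx => hx.2)
      (.of_forall fun _ => ofReal_ne_top)

end
end
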